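/- Let G be a connected subcubic graph with no two vertex-disjoint cycles each of length less than 5. Then one of the following holds: (1) G = K_4 or G contains K_4^+ as a subgraph; (2) r_5(G) = 2/5 and G is obtained from a disjoint union of one graph in ⋃_{j=0}^{3} F_{3,j} and copies of graphs in ⋃_{j=0}^{3} F_{4,j} by adding edges between different constituent graphs such that each added edge is a cut-edge of G; (3) r_5(G) = 1/5 and either (a) some block of G is isomorphic to a member of ⋃_{j=0}^{2} F_{3,j}, or (b) G ∈ F^5_{3,1,k} for some integer k ≥ 0, or (c) G is obtained from a disjoint union of copies of members of ⋃_{j=0}^{4} F_{4,j} ∪ ⋃_{k≥0} F^5_{3,0,k} by adding edges between different constituent graphs such that each added edge is a cut-edge of G; (4) r_5(G) ≤ 0. -/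

import Mathlib

open SimpleGraph

namespace InducedForest

/-- A graph is subcubic if every vertex has at most 3 neighbours. -/
def Subcubic {V : Type} (G : SimpleGraph V) : Prop := ∀ v : V, (G.neighborSet v).ncard ≤ 3

/-- A graph is cubic if every vertex has exactly 3 neighbours. -/
def Cubic {V : Type} (G : SimpleGraph V) : Prop := ∀ v : V, (G.neighborSet v).ncard = 3

/-- `S` is a feedback vertex set of `G` iff `G - S` is a forest. -/
def IsFVS {V : Type} (G : SimpleGraph V) (S : Set V) : Prop := (G.induce Sᶜ).IsAcyclic

/-- `φ(G)`: the minimum size of a feedback vertex set of `G`. -/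
noncomputable def fvs {V : Type} (G : SimpleGraph V) : ℕ :=
  sInf {n : ℕ | ∃ S : Set V, IsFVS G S ∧ S.ncard = n}

/-- `a(G)`: the maximum number of vertices of an induced forest in `G`. -/
noncomputable def indForestNum {V : Type} (G : SimpleGraph V) : ℕ :=
  sSup {n : ℕ | ∃ S : Set V, (G.induce S).IsAcyclic ∧ S.ncard = n}

/-- `v` is a cut-vertex of `G`: deleting it increases the number of connected components. -/
def IsCutVertex {V : Type} (G : SimpleGraph V) (v : V) : Prop :=
  Nat.card G.ConnectedComponent < Nat.card (G.induce {u | u ≠ v}).ConnectedComponent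

/-- `B` is a block of `G`: a maximal set of vertices inducing a connected subgraph
without cut-vertices. -/
def IsBlock {V : Type} (G : SimpleGraph V) (B : Set V) : Prop :=
  ((G.induce B).Connected ∧ ∀ v, ¬ IsCutVertex (G.induce B) v) ∧
  ∀ B' : Set V, B ⊆ B' →
    ((G.induce B').Connected ∧ ∀ v, ¬ IsCutVertex (G.induce B') v) → B' = B

/-- 2-connectedness: at least 3 vertices and removing fewer than 2 vertices
leaves a connected graph. -/
def TwoConnected {V : Type} (G : SimpleGraph V) : Prop :=
  3 ≤ Nat.card V ∧ ∀ s : Set V, s.ncard < 2 → (G.induce sᶜ).Connected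

/-- 3-connectedness: at least 4 vertices and removing fewer than 3 vertices
leaves a connected graph. -/
def ThreeConnected {V : Type} (G : SimpleGraph V) : Prop :=
  4 ≤ Nat.card V ∧ ∀ s : Set V, s.ncard < 3 → (G.induce sᶜ).Connected

/-- The graph obtained from `H` by subdividing the edge `xy` once;
the subdivision vertex is `none`. -/
def subdivide {V : Type} (H : SimpleGraph V) (x y : V) : SimpleGraph (Option V) :=
  SimpleGraph.fromRel (fun p q =>
    match p, q with
    | some u, some v => H.Adj u v ∧ s(u, v) ≠ s(x, y)
    | some u, none => u = x ∨ u = y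
    | _, _ => False)

/-- `G` is obtained from `H` by subdividing one edge once. -/
def IsSubdivisionOfOneEdge {V W : Type} (H : SimpleGraph V) (G : SimpleGraph W) : Prop :=
  ∃ x y : V, H.Adj x y ∧ Nonempty (G ≃g subdivide H x y)

/-- The graph obtained from `K` by adding one new vertex (`none`)
joined to all vertices of `S`. -/
def addApex {V : Type} (K : SimpleGraph V) (S : Set V) : SimpleGraph (Option V) :=
  SimpleGraph.fromRel (fun p q =>
    match p, q with
    | some u, some v => K.Adj u v
    | some u, none => u ∈ S
    | _, _ => False)

/-- `G` is (isomorphic to) `H ∘ (e1, e2, a)`: subdivide `e1` and `e2` once each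
(with `e1` subdivided twice if `e1 = e2`) and add a new vertex adjacent to `a` and to the
two subdivision vertices. -/
def IsCircOp {V W : Type} (H : SimpleGraph V) (e1 e2 : Sym2 V) (a : V)
    (G : SimpleGraph W) : Prop :=
  (e1 ≠ e2 ∧ ∃ x1 y1 x2 y2 : V, e1 = s(x1, y1) ∧ e2 = s(x2, y2) ∧
    Nonempty (G ≃g addApex (subdivide (subdivide H x1 y1) (some x2) (some y2))
      {some (some a), some none, none})) ∨
  (e1 = e2 ∧ ∃ x y : V, e1 = s(x, y) ∧
    Nonempty (G ≃g addApex (subdivide (subdivide H x y) none (some y))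
      {some (some a), some none, none}))

/-- The cycle of length `n` (for `n ≥ 3`). -/
def cyc (n : ℕ) : SimpleGraph (ZMod n) :=
  SimpleGraph.fromRel (fun u v => v = u + 1)

/-- The families `F_{i,j}` of graphs (closed under isomorphism):
`F_{i,0} = {C_i}` for `i ≥ 3`; `F_{1,1} = {K_4}`; `F_{j,j}` for `j ≥ 2` is obtained from
`F_{j-1,j-1}` by subdividing one edge once and then applying the `∘` operation at the
subdivision vertex; and `F_{i,j}` for `i > j ≥ 1` is obtained from `F_{j,j}` by `i - j`
successive single-edge subdivisions. -/
inductive MemF : ℕ → ℕ → ∀ {V : Type}, SimpleGraph V → Prop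
  | cycle {i : ℕ} (hi : 3 ≤ i) {V : Type} {G : SimpleGraph V}
      (h : Nonempty (G ≃g cyc i)) : MemF i 0 G
  | k4 {V : Type} {G : SimpleGraph V}
      (h : Nonempty (G ≃g (⊤ : SimpleGraph (Fin 4)))) : MemF 1 1 G
  | circ {j : ℕ} (hj : 2 ≤ j) {V : Type} {H : SimpleGraph V}
      (hH : MemF (j - 1) (j - 1) H) {x y : V} (hxy : H.Adj x y)
      {e1 e2 : Sym2 (Option V)} (he1 : e1 ∈ (subdivide H x y).edgeSet)
      (he2 : e2 ∈ (subdivide H x y).edgeSet)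
      {W : Type} {G : SimpleGraph W}
      (hG : IsCircOp (subdivide H x y) e1 e2 none G) : MemF j j G
  | subd {i j : ℕ} (hj : 1 ≤ j) {V : Type} {H : SimpleGraph V}
      (hH : MemF i j H) {x y : V} (hxy : H.Adj x y) {W : Type} {G : SimpleGraph W}
      (hG : Nonempty (G ≃g subdivide H x y)) : MemF (i + 1) j G

/-- `K_4^+`: the graph obtained from `K_4` by subdividing one edge once. -/
def K4plus : SimpleGraph (Option (Fin 4)) :=
  subdivide (⊤ : SimpleGraph (Fin 4)) 0 1

/-- `L`: the graph obtained from `K_4` by subdividing once each edge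
of a perfect matching. -/
def Lgraph : SimpleGraph (Option (Option (Fin 4))) :=
  subdivide (subdivide (⊤ : SimpleGraph (Fin 4)) 0 1) (some 2) (some 3)

/-- The Petersen graph. -/
def petersen : SimpleGraph (ZMod 5 × Fin 2) :=
  SimpleGraph.fromRel (fun u v =>
    (u.2 = 0 ∧ v.2 = 0 ∧ v.1 = u.1 + 1) ∨
    (u.2 = 1 ∧ v.2 = 1 ∧ v.1 = u.1 + 2) ∨
    (u.2 = 0 ∧ v.2 = 1 ∧ u.1 = v.1))

/-- `R`: the Petersen graph minus one edge. -/
def Rgraph : SimpleGraph (ZMod 5 × Fin 2) :=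
  petersen.deleteEdges {s(((0 : ZMod 5), (0 : Fin 2)), ((1 : ZMod 5), (0 : Fin 2)))}

/-- `Q_3`: the 3-dimensional cube graph. -/
def Q3 : SimpleGraph (Fin 2 × Fin 2 × Fin 2) :=
  SimpleGraph.fromRel (fun u v =>
    (u.1 ≠ v.1 ∧ u.2 = v.2) ∨ (u.1 = v.1 ∧ u.2.1 ≠ v.2.1 ∧ u.2.2 = v.2.2) ∨
    (u.1 = v.1 ∧ u.2.1 = v.2.1 ∧ u.2.2 ≠ v.2.2))

/-- `V_8`: the Wagner graph. -/
def V8 : SimpleGraph (ZMod 8) :=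
  SimpleGraph.fromRel (fun u v => v = u + 1 ∨ v = u + 4)

/-- The dodecahedron, presented as the generalized Petersen graph `GP(10,2)`. -/
def dodecahedron : SimpleGraph (ZMod 10 × Fin 2) :=
  SimpleGraph.fromRel (fun u v =>
    (u.2 = 0 ∧ v.2 = 0 ∧ v.1 = u.1 + 1) ∨
    (u.2 = 1 ∧ v.2 = 1 ∧ v.1 = u.1 + 2) ∨
    (u.2 = 0 ∧ v.2 = 1 ∧ u.1 = v.1))

/-- The families `F^g_{i,j,k}`: 2-connected subcubic graphs obtained from the disjoint
union of `k` copies of `L` (when `g = 4`) or of `R` (when `g = 5`) and one member of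
`F_{i,j}` by adding `k+1` edges; when `k ≥ 1`, each added edge joins two different
constituent copies. -/
def MemFG (g i j k : ℕ) {W : Type} (G : SimpleGraph W) : Prop :=
  TwoConnected G ∧ Subcubic G ∧
  ∃ (P : W → Fin (k + 1)) (H : SimpleGraph W),
    H ≤ G ∧ (∀ u v, H.Adj u v → P u = P v) ∧
    MemF i j (H.induce (P ⁻¹' {0})) ∧
    ((g = 4 ∧ ∀ l : Fin (k + 1), l ≠ 0 → Nonempty ((H.induce (P ⁻¹' {l})) ≃g Lgraph)) ∨
     (g = 5 ∧ ∀ l : Fin (k + 1), l ≠ 0 → Nonempty ((H.induce (P ⁻¹' {l})) ≃g Rgraph))) ∧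
    (G.edgeSet \ H.edgeSet).ncard = k + 1 ∧
    (1 ≤ k → ∀ u v, G.Adj u v → ¬ H.Adj u v → P u ≠ P v)

/-- `t_4 = 2/9`, `t_5 = 1/5`. -/
noncomputable def tg (g : ℕ) : ℝ := if g = 4 then 2 / 9 else 1 / 5

/-- The error function `ε_g` on graphs. -/
noncomputable def eps (g : ℕ) {V : Type} (G : SimpleGraph V) : ℝ := by
  classical
  exact
    if h1 : ∃ p : ℕ × ℕ, 1 ≤ p.1 ∧ p.2 ≤ p.1 ∧ MemF p.1 p.2 G then
      max (1 - (h1.choose.2 : ℝ) * (5 * tg g - 1) - (h1.choose.1 : ℝ) * tg g) 0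
    else if h2 : ∃ q : ℕ × ℕ × ℕ, 1 ≤ q.1 ∧ q.2.1 ≤ q.1 ∧ MemFG g q.1 q.2.1 q.2.2 G then
      max (1 - tg g - (h2.choose.2.1 : ℝ) * (5 * tg g - 1) - (h2.choose.1 : ℝ) * tg g) 0
    else if Nonempty (G ≃g (⊤ : SimpleGraph (Fin 2))) then -tg g
    else 0

/-- The error function `r_g(G)`: the sum of `ε_g(B)` over all blocks `B` of `G`. -/
noncomputable def rg (g : ℕ) {V : Type} (G : SimpleGraph V) : ℝ :=
  ∑ᶠ B ∈ {B : Set V | IsBlock G B}, eps g (G.induce B)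

/-- `G` has two vertex-disjoint cycles, each of length less than `g`. -/
def TwoDisjointCyclesLt {V : Type} (G : SimpleGraph V) (g : ℕ) : Prop :=
  ∃ (u v : V) (c1 : G.Walk u u) (c2 : G.Walk v v), c1.IsCycle ∧ c2.IsCycle ∧
    c1.length < g ∧ c2.length < g ∧ ∀ x, x ∈ c1.support → x ∉ c2.support

/-- `G` contains a (not necessarily induced) subgraph isomorphic to `K`. -/
def ContainsSubgraphCopy {U V : Type} (K : SimpleGraph U) (G : SimpleGraph V) : Prop :=
  ∃ f : U → V, Function.Injective f ∧ ∀ u v, K.Adj u v → G.Adj (f u) (f v)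

/-- `G` is obtained from `H` by adding edges, each of which is a cut-edge of `G`. -/
def AddCutEdges {V : Type} (H G : SimpleGraph V) : Prop :=
  H ≤ G ∧ ∀ e ∈ G.edgeSet \ H.edgeSet, G.IsBridge e

/-- The edges of `H` all lie inside the parts of the partition given by `P`. -/
def PartitionedBy {V ι : Type} (H : SimpleGraph V) (P : V → ι) : Prop :=
  ∀ u v, H.Adj u v → P u = P v

/-- `G` is `g`-minimal: a minimum counterexample to the main theorem. -/
def GMinimal (g : ℕ) {V : Type} [Fintype V] (G : SimpleGraph V) : Prop :=
  Subcubic G ∧ ¬ TwoDisjointCyclesLt G g ∧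
  tg g * G.edgeSet.ncard + rg g G < (fvs G : ℝ) ∧
  ∀ (W : Type) [Fintype W] (H : SimpleGraph W), Nat.card W < Nat.card V →
    Subcubic H → ¬ TwoDisjointCyclesLt H g →
    (fvs H : ℝ) ≤ tg g * H.edgeSet.ncard + rg g H

section Part1

variable {V W : Type}

/-- degree -/
noncomputable def dg (G : SimpleGraph V) (v : V) : ℕ := (G.neighborSet v).ncard

section adj
variable {H : SimpleGraph V} {x y : V}

lemma sub_ss {u v : V} : (subdivide H x y).Adj (some u) (some v) ↔ H.Adj u v ∧ s(u, v) ≠ s(x, y) := by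
  simp only [subdivide, fromRel_adj, ne_eq, Option.some.injEq]
  constructor
  · rintro ⟨_, h | h⟩
    · exact h
    · exact ⟨h.1.symm, by rw [Sym2.eq_swap]; exact h.2⟩
  · intro h
    exact ⟨h.1.ne, Or.inl h⟩

lemma sub_sn {u : V} : (subdivide H x y).Adj (some u) none ↔ u = x ∨ u = y := by
  simp [subdivide]

lemma sub_ns {u : V} : (subdivide H x y).Adj none (some u) ↔ u = x ∨ u = y := by
  simp [subdivide]

lemma apex_ss {S : Set V} {u v : V} : (addApex H S).Adj (some u) (some v) ↔ H.Adj u v := by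
  simp only [addApex, fromRel_adj, ne_eq, Option.some.injEq]
  constructor
  · rintro ⟨_, h | h⟩
    · exact h
    · exact h.symm
  · intro h
    exact ⟨h.ne, Or.inl h⟩

lemma apex_sn {S : Set V} {u : V} : (addApex H S).Adj (some u) none ↔ u ∈ S := by
  simp [addApex]

lemma apex_ns {S : Set V} {u : V} : (addApex H S).Adj none (some u) ↔ u ∈ S := by
  simp [addApex]

end adj

/-- subdivide respects isomorphisms -/
def subIso {H : SimpleGraph V} {K : SimpleGraph W} (f : H ≃g K) (x y : V) :
    subdivide H x y ≃g subdivide K (f x) (f y) where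
  toEquiv := Equiv.optionCongr f.toEquiv
  map_rel_iff' := by
    intro a b
    have key : ∀ u v : V, s(f u, f v) = s(f x, f y) ↔ s(u, v) = s(x, y) := by
      intro u v
      simp
    rcases a with _ | a <;> rcases b with _ | b
    · simp
    · simp [sub_ns]
    · simp [sub_sn]
    · simp only [Equiv.optionCongr_apply, Option.map_some, sub_ss]
      change K.Adj (f a) (f b) ∧ s(f a, f b) ≠ s(f x, f y) ↔ _
      rw [f.map_adj_iff, ne_eq, key]

def apexIso {H : SimpleGraph V} {K : SimpleGraph W} (f : H ≃g K) (S : Set V) :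
    addApex H S ≃g addApex K (f '' S) where
  toEquiv := Equiv.optionCongr f.toEquiv
  map_rel_iff' := by
    intro a b
    rcases a with _ | a <;> rcases b with _ | b
    · simp
    · simp [apex_ns]
    · simp [apex_sn]
    · simp only [Equiv.optionCongr_apply, Option.map_some, apex_ss]
      exact f.map_adj_iff

lemma dg_iso {G : SimpleGraph V} {K : SimpleGraph W} (f : G ≃g K) (v : V) :
    dg K (f v) = dg G v := by
  unfold dg
  have : K.neighborSet (f v) = f '' (G.neighborSet v) := by
    ext w
    simp only [mem_neighborSet, Set.mem_image]
    constructor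
    · intro h
      refine ⟨f.symm w, ?_, by simp⟩
      rw [← f.map_adj_iff]; simpa using h
    · rintro ⟨u, hu, rfl⟩
      exact f.map_adj_iff.2 hu
  rw [this, Set.ncard_image_of_injective _ f.injective]

lemma dg_sub_some [Finite V] {H : SimpleGraph V} {x y : V} (h : H.Adj x y) (u : V) :
    dg (subdivide H x y) (some u) = dg H u := by
  classical
  unfold dg
  by_cases hu : u = x ∨ u = y
  · obtain ⟨z, hz, hz'⟩ : ∃ z, H.Adj u z ∧ s(x, y) = s(u, z) := by
      rcases hu with rfl | rfl
      · exact ⟨y, h, rfl⟩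
      · exact ⟨x, h.symm, Sym2.eq_swap⟩
    have : (subdivide H x y).neighborSet (some u) = 
        insert none (some '' (H.neighborSet u \ {z})) := by
      ext w
      rcases w with _ | w
      · simp [sub_sn, hu]
      · simp only [mem_neighborSet, sub_ss, hz']
        have := hz.ne
        simp
        intro _ _ h; exact absurd h this
    rw [this, Set.ncard_insert_of_notMem (by simp) (Set.toFinite _),
      Set.ncard_image_of_injective _ (Option.some_injective _),
      Set.ncard_sdiff_singleton_add_one (by simpa using hz) (Set.toFinite _)]
  · have : (subdivide H x y).neighborSet (some u) = some '' (H.neighborSet u) := by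
      ext w
      rcases w with _ | w
      · simpa [sub_sn] using hu
      · simp only [mem_neighborSet, sub_ss]
        simp
        intro _
        push Not at hu
        simp [hu.1, hu.2]
    rw [this, Set.ncard_image_of_injective _ (Option.some_injective _)]

lemma dg_sub_none {H : SimpleGraph V} {x y : V} (h : H.Adj x y) :
    dg (subdivide H x y) none = 2 := by
  unfold dg
  have : (subdivide H x y).neighborSet none = {some x, some y} := by
    ext w
    rcases w with _ | w
    · simp
    · simp [sub_ns]
  rw [this, Set.ncard_pair]
  simpa using h.ne

open Classical in
lemma dg_apex_some [Finite V] {H : SimpleGraph V} {S : Set V} (u : V) :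
    dg (addApex H S) (some u) = dg H u + if u ∈ S then 1 else 0 := by
  unfold dg
  split_ifs with hu
  · have : (addApex H S).neighborSet (some u) = insert none (some '' (H.neighborSet u)) := by
      ext w
      rcases w with _ | w
      · simp [apex_sn, hu]
      · simp [apex_ss]
    rw [this, Set.ncard_insert_of_notMem (by simp) (Set.toFinite _),
      Set.ncard_image_of_injective _ (Option.some_injective _)]
  · have : (addApex H S).neighborSet (some u) = (some '' (H.neighborSet u)) := by
      ext w
      rcases w with _ | w
      · simp [apex_sn, hu]
      · simp [apex_ss]
    rw [this, Set.ncard_image_of_injective _ (Option.some_injective _), add_zero]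

lemma dg_apex_none {H : SimpleGraph V} {S : Set V} :
    dg (addApex H S) none = S.ncard := by
  unfold dg
  have : (addApex H S).neighborSet none = some '' S := by
    ext w
    rcases w with _ | w
    · simp
    · simp [apex_ns]
  rw [this, Set.ncard_image_of_injective _ (Option.some_injective _)]

/-- total deficiency -/
noncomputable def dfc (G : SimpleGraph V) : ℤ := ∑ᶠ v, (3 - (dg G v : ℤ))

lemma dfc_iso {G : SimpleGraph V} {K : SimpleGraph W} (f : G ≃g K) : dfc G = dfc K := by
  unfold dfc
  rw [← finsum_comp_equiv f.toEquiv]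
  refine finsum_congr fun v => ?_
  congr 2
  exact (dg_iso f v).symm

lemma dfc_sub [Finite V] {H : SimpleGraph V} {x y : V} (h : H.Adj x y) :
    dfc (subdivide H x y) = dfc H + 1 := by
  classical
  have := Fintype.ofFinite V
  unfold dfc
  rw [finsum_eq_sum_of_fintype, finsum_eq_sum_of_fintype, Fintype.sum_option]
  simp only [dg_sub_some h, dg_sub_none h]
  push_cast
  ring

lemma dfc_apex [Finite V] {H : SimpleGraph V} {S : Set V} (hS : S.ncard = 3) :
    dfc (addApex H S) = dfc H - 3 := by
  classical
  have := Fintype.ofFinite V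
  unfold dfc
  rw [finsum_eq_sum_of_fintype, finsum_eq_sum_of_fintype, Fintype.sum_option]
  simp only [dg_apex_some, dg_apex_none, hS]
  push_cast
  rw [show ∑ x : V, ((3 : ℤ) - (dg H x + if x ∈ S then 1 else 0)) =
    ∑ x : V, (3 - (dg H x : ℤ)) - ∑ x : V, (if x ∈ S then 1 else 0) by
      rw [← Finset.sum_sub_distrib]; exact Finset.sum_congr rfl fun _ _ => by ring]
  rw [Finset.sum_boole]
  have : (Finset.univ.filter (· ∈ S)).card = 3 := by
    rw [← hS, Set.ncard_eq_toFinset_card']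
    congr 1; ext; simp
  rw [this]; push_cast; ring

lemma cubic_of_dfc [Finite V] {G : SimpleGraph V} (h : ∀ v, dg G v ≤ 3) (h0 : dfc G ≤ 0) (v : V) :
    dg G v = 3 := by
  classical
  have := Fintype.ofFinite V
  unfold dfc at h0
  rw [finsum_eq_sum_of_fintype] at h0
  have h1 : ∀ v ∈ Finset.univ, 0 ≤ (3 : ℤ) - dg G v := fun v _ => by have := h v; omega
  have h2 := Finset.single_le_sum h1 (Finset.mem_univ v)
  have := h v
  omega

structure Inv (i j : ℕ) (G : SimpleGraph V) : Prop where
  fin : Finite V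
  card : 3 ≤ Nat.card V
  le : j ≤ i
  deg : ∀ v, dg G v ≤ 3
  dfc : dfc G = i - j

lemma Inv.iso {i j : ℕ} {G : SimpleGraph V} {K : SimpleGraph W} (h : Inv i j G) (f : K ≃g G) :
    Inv i j K := by
  have := h.fin
  refine ⟨Finite.of_equiv _ f.symm.toEquiv, ?_, h.le, ?_, ?_⟩
  · rw [Nat.card_congr f.toEquiv]; exact h.card
  · intro v; rw [← dg_iso f]; exact h.deg _
  · rw [dfc_iso f]; exact h.dfc

lemma Inv.sub {i j : ℕ} {G : SimpleGraph V} (h : Inv i j G) {x y : V} (hxy : G.Adj x y) :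
    Inv (i + 1) j (subdivide G x y) := by
  have := h.fin
  refine ⟨inferInstance, ?_, ?_, ?_, ?_⟩
  · have := h.card
    rw [Finite.card_option]; omega
  · have := h.le; omega
  · rintro (_ | v)
    · rw [dg_sub_none hxy]; norm_num
    · rw [dg_sub_some hxy]; exact h.deg v
  · rw [dfc_sub hxy, h.dfc]; push_cast; ring

lemma Inv.apex {i j : ℕ} {G : SimpleGraph V} (h : Inv (i + 3) j G) (hij : j ≤ i) {S : Set V}
    (hS : S.ncard = 3) (hd : ∀ v ∈ S, dg G v ≤ 2) : Inv i j (addApex G S) := by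
  classical
  have := h.fin
  refine ⟨inferInstance, ?_, hij, ?_, ?_⟩
  · have := h.card
    rw [Finite.card_option]; omega
  · rintro (_ | v)
    · rw [dg_apex_none, hS]
    · rw [dg_apex_some]
      split_ifs with hv
      · have := hd v hv; omega
      · exact h.deg v
  · rw [dfc_apex hS, h.dfc]; push_cast; ring

lemma Inv.of_memF {i j : ℕ} {G : SimpleGraph V} (h : MemF i j G) : Inv i j G := by
  induction h with
  | @cycle i hi V G h =>
    obtain ⟨f⟩ := h
    refine Inv.iso ?_ f
    have : NeZero i := ⟨by omega⟩
    have hd : ∀ v, dg (cyc i) v = 2 := by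
      intro v
      have h1 : (1 : ZMod i) ≠ 0 := by
        have : Fact (1 < i) := ⟨by omega⟩
        exact one_ne_zero
      have h2 : (1 : ZMod i) + 1 ≠ 0 := by
        intro h
        have : ((2 : ℕ) : ZMod i) = 0 := by push_cast; rw [← h]; norm_num
        rw [ZMod.natCast_eq_zero_iff] at this
        have := Nat.le_of_dvd (by norm_num) this
        omega
      unfold dg
      have : (cyc i).neighborSet v = {v + 1, v - 1} := by
        ext w
        simp only [cyc, mem_neighborSet, fromRel_adj, Set.mem_insert_iff, Set.mem_singleton_iff]
        constructor
        · rintro ⟨_, h | h⟩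
          · exact Or.inl h
          · right; rw [h]; ring
        · rintro (h | h)
          · refine ⟨?_, Or.inl h⟩
            rw [h]; intro h3; exact h1 (by simpa using h3)
          · refine ⟨?_, Or.inr (by rw [h]; ring)⟩
            rw [h]; intro h3; exact h1 (by linear_combination h3)
      rw [this, Set.ncard_pair]
      intro h3
      apply h2
      linear_combination h3
    refine ⟨inferInstance, by simpa using hi, by omega, fun v => by rw [hd]; norm_num, ?_⟩
    rw [InducedForest.dfc, finsum_eq_sum_of_fintype]
    simp [hd]
  | k4 h =>
    obtain ⟨f⟩ := h
    refine Inv.iso ?_ f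
    have hd : ∀ v, dg (⊤ : SimpleGraph (Fin 4)) v = 3 := by
      intro v
      unfold dg
      rw [Set.ncard_eq_toFinset_card']
      revert v
      decide
    refine ⟨inferInstance, by simp, le_rfl, fun v => by rw [hd], ?_⟩
    rw [InducedForest.dfc, finsum_eq_sum_of_fintype]
    simp [hd]
  | @circ j hj V H hH x y hxy e1 e2 he1 he2 W G hG ih =>
    have h1 := ih.sub hxy
    have := h1.fin
    obtain ⟨j, rfl⟩ : ∃ k, j = k + 1 := ⟨j - 1, by omega⟩
    have hI : ∀ {U : Type} {K : SimpleGraph U} {S : Set U}, Inv (j + 1 - 1 + 1 + 1 + 1) (j + 1 - 1) K →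
        S.ncard = 3 → (∀ v ∈ S, dg K v ≤ 2) → Inv (j + 1) (j + 1) (addApex K S) := by
      intro U K S hK hS hd
      have h3 : Inv j j (addApex K S) := Inv.apex (i := j) (j := j) hK le_rfl hS hd
      exact ⟨h3.fin, h3.card, le_rfl, h3.deg, by rw [h3.dfc]; push_cast; ring⟩
    rcases hG with ⟨hne, x1, y1, x2, y2, rfl, rfl, ⟨f⟩⟩ | ⟨rfl, x1, y1, rfl, ⟨f⟩⟩
    · rw [mem_edgeSet] at he1 he2
      have h4 : (subdivide (subdivide H x y) x1 y1).Adj (some x2) (some y2) :=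
        sub_ss.2 ⟨he2, hne.symm⟩
      refine Inv.iso (hI ((h1.sub he1).sub h4) ?_ ?_) f
      · rw [Set.ncard_eq_three]
        exact ⟨_, _, _, by simp, by simp, by simp, rfl⟩
      · rintro v (rfl | rfl | rfl)
        · rw [dg_sub_some h4, dg_sub_some he1]
          have := ih.fin
          rw [dg_sub_none hxy]
        · rw [dg_sub_some h4, dg_sub_none he1]
        · rw [dg_sub_none h4]
    · rw [mem_edgeSet] at he1
      have h4 : (subdivide (subdivide H x y) x1 y1).Adj none (some y1) :=
        sub_ns.2 (Or.inr rfl)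
      refine Inv.iso (hI ((h1.sub he1).sub h4) ?_ ?_) f
      · rw [Set.ncard_eq_three]
        exact ⟨_, _, _, by simp, by simp, by simp, rfl⟩
      · rintro v (rfl | rfl | rfl)
        · rw [dg_sub_some h4, dg_sub_some he1]
          have := ih.fin
          rw [dg_sub_none hxy]
        · rw [dg_sub_some h4, dg_sub_none he1]
        · rw [dg_sub_none h4]
  | subd hj hH hxy hG ih =>
    obtain ⟨f⟩ := hG
    exact (ih.sub hxy).iso f

end Part1

section Part2

variable {V W : Type}

/-- `a b c d` is a closed walk tracing a triangle (when `c = d`) or a 4-cycle. -/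
def SC (G : SimpleGraph V) (a b c d : V) : Prop :=
  G.Adj a b ∧ G.Adj b c ∧ (c = d ∨ G.Adj c d) ∧ G.Adj d a ∧ a ≠ c ∧ b ≠ d

/-- There is a short cycle within the set `S`. -/
def ShortIn (G : SimpleGraph V) (S : Set V) : Prop :=
  ∃ a b c d, SC G a b c d ∧ a ∈ S ∧ b ∈ S ∧ c ∈ S ∧ d ∈ S

/-- Two disjoint short cycles. -/
def TwoSC (G : SimpleGraph V) : Prop := ∃ S T : Set V, Disjoint S T ∧ ShortIn G S ∧ ShortIn G T

lemma SC.map {G : SimpleGraph V} {K : SimpleGraph W} {a b c d : V} (h : SC G a b c d) (f : V → W)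
    (hf : Function.Injective f) (hh : ∀ u v, G.Adj u v → K.Adj (f u) (f v)) :
    SC K (f a) (f b) (f c) (f d) := by
  obtain ⟨h1, h2, h3, h4, h5, h6⟩ := h
  exact ⟨hh _ _ h1, hh _ _ h2, h3.imp (congrArg f) (hh _ _), hh _ _ h4, hf.ne h5, hf.ne h6⟩

lemma ShortIn.map {G : SimpleGraph V} {K : SimpleGraph W} {S : Set V} (h : ShortIn G S) (f : V → W)
    (hf : Function.Injective f) (hh : ∀ u v, G.Adj u v → K.Adj (f u) (f v)) :
    ShortIn K (f '' S) := by
  obtain ⟨a, b, c, d, h1, ha, hb, hc, hd⟩ := h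
  exact ⟨_, _, _, _, h1.map f hf hh, ⟨a, ha, rfl⟩, ⟨b, hb, rfl⟩, ⟨c, hc, rfl⟩, ⟨d, hd, rfl⟩⟩

lemma ShortIn.mono {G : SimpleGraph V} {S T : Set V} (h : ShortIn G S) (hST : S ⊆ T) :
    ShortIn G T := by
  obtain ⟨a, b, c, d, h1, ha, hb, hc, hd⟩ := h
  exact ⟨a, b, c, d, h1, hST ha, hST hb, hST hc, hST hd⟩

lemma TwoSC.map {G : SimpleGraph V} {K : SimpleGraph W} (h : TwoSC G) (f : V → W)
    (hf : Function.Injective f) (hh : ∀ u v, G.Adj u v → K.Adj (f u) (f v)) :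
    TwoSC K := by
  obtain ⟨S, T, hd, hS, hT⟩ := h
  exact ⟨f '' S, f '' T, (Set.disjoint_image_iff hf).2 hd, hS.map f hf hh, hT.map f hf hh⟩

lemma ShortIn.walk {G : SimpleGraph V} {S : Set V} (h : ShortIn G S) :
    ∃ (u : V) (p : G.Walk u u), p.IsCycle ∧ p.length < 5 ∧ ∀ x ∈ p.support, x ∈ S := by
  obtain ⟨a, b, c, d, ⟨h1, h2, h3, h4, h5, h6⟩, ha, hb, hc, hd⟩ := h
  rcases h3 with rfl | h3
  · refine ⟨a, .cons h1 (.cons h2 (.cons h4 .nil)), ?_, by simp, ?_⟩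
    · have := h1.ne
      have := h2.ne
      simp [Walk.isCycle_def, Walk.isTrail_def]
      grind
    · simp [ha, hb, hc]
  · refine ⟨a, .cons h1 (.cons h2 (.cons h3 (.cons h4 .nil))), ?_, by simp, ?_⟩
    · have := h1.ne
      have := h2.ne
      have := h3.ne
      have := h4.ne
      simp [Walk.isCycle_def, Walk.isTrail_def]
      grind
    · simp [ha, hb, hc, hd]

lemma TwoSC.two {G : SimpleGraph V} (h : TwoSC G) : TwoDisjointCyclesLt G 5 := by
  obtain ⟨S, T, hd, hS, hT⟩ := h
  obtain ⟨u, p, hp, hl, hs⟩ := hS.walk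
  obtain ⟨v, q, hq, hl', hs'⟩ := hT.walk
  exact ⟨u, v, p, q, hp, hq, hl, hl', fun x hx hx' =>
    Set.disjoint_left.1 hd (hs x hx) (hs' x hx')⟩

instance subDec [DecidableEq V] (H : SimpleGraph V) [DecidableRel H.Adj] (x y : V) :
    DecidableRel (subdivide H x y).Adj := fun p q =>
  match p, q with
  | some u, some v =>
    decidable_of_iff (H.Adj u v ∧ ¬ ((u = x ∧ v = y) ∨ (u = y ∧ v = x))) (by rw [sub_ss]; simp)
  | some u, none => decidable_of_iff (u = x ∨ u = y) sub_sn.symm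
  | none, some u => decidable_of_iff (u = x ∨ u = y) sub_ns.symm
  | none, none => .isFalse (by simp)

instance apexDec [DecidableEq V] (H : SimpleGraph V) [DecidableRel H.Adj] (a b c : V) :
    DecidableRel (addApex H {a, b, c}).Adj := fun p q =>
  match p, q with
  | some u, some v => decidable_of_iff (H.Adj u v) apex_ss.symm
  | some u, none => decidable_of_iff (u = a ∨ u = b ∨ u = c) (by rw [apex_sn]; simp)
  | none, some u => decidable_of_iff (u = a ∨ u = b ∨ u = c) (by rw [apex_ns]; simp)
  | none, none => .isFalse (by simp)

instance scDec [DecidableEq V] (H : SimpleGraph V) [DecidableRel H.Adj] (a b c d : V) :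
    Decidable (SC H a b c d) := by unfold SC; infer_instance

/-- names of the 8 vertices -/
def vt : Fin 8 → Option (Option (Option (Option (Fin 4))))
  | 0 => some (some (some (some 0)))
  | 1 => some (some (some (some 1)))
  | 2 => some (some (some (some 2)))
  | 3 => some (some (some (some 3)))
  | 4 => some (some (some none))
  | 5 => some (some none)
  | 6 => some none
  | 7 => none

lemma vt_inj : Function.Injective vt := by decide

/-- certificates: pairs of disjoint 4-tuples -/
def certs : List ((Fin 8 × Fin 8 × Fin 8 × Fin 8) × (Fin 8 × Fin 8 × Fin 8 × Fin 8)) :=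
  [((0, 2, 3, 3), (4, 5, 7, 7)),
   ((0, 2, 3, 3), (5, 6, 7, 7)),
   ((0, 3, 1, 4), (2, 5, 7, 6)),
   ((1, 2, 3, 3), (0, 4, 7, 5)),
   ((0, 2, 1, 4), (3, 5, 7, 6)),
   ((1, 2, 3, 3), (4, 5, 7, 7)),
   ((0, 2, 3, 3), (1, 4, 7, 5)),
   ((5, 6, 7, 7), (0, 2, 1, 4)),
   ((4, 5, 7, 7), (0, 2, 1, 3)),
   ((1, 2, 3, 3), (0, 5, 7, 6)),
   ((0, 2, 3, 3), (4, 6, 7, 7)),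
   ((4, 6, 7, 7), (0, 2, 1, 3)),
   ((0, 2, 3, 5), (1, 4, 7, 6)),
   ((1, 2, 3, 3), (5, 6, 7, 7)),
   ((0, 3, 2, 6), (1, 4, 7, 5)),
   ((0, 4, 7, 6), (1, 3, 2, 5)),
   ((0, 3, 2, 5), (1, 4, 7, 6))]

/-- disjointness of the certificate -/
def cdisj (p : (Fin 8 × Fin 8 × Fin 8 × Fin 8) × (Fin 8 × Fin 8 × Fin 8 × Fin 8)) : Prop :=
  ∀ u : Fin 8, (u = p.1.1 ∨ u = p.1.2.1 ∨ u = p.1.2.2.1 ∨ u = p.1.2.2.2) →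
    ¬ (u = p.2.1 ∨ u = p.2.2.1 ∨ u = p.2.2.2.1 ∨ u = p.2.2.2.2)

instance : DecidablePred cdisj := fun p => by unfold cdisj; infer_instance

lemma certs_disj : ∀ p ∈ certs, cdisj p := by decide

instance : DecidableRel K4plus.Adj := by unfold K4plus; infer_instance

/-- some certificate is valid in `G` -/
def HasCert (G : SimpleGraph (Option (Option (Option (Option (Fin 4)))))) : Prop :=
  ∃ p ∈ certs, SC G (vt p.1.1) (vt p.1.2.1) (vt p.1.2.2.1) (vt p.1.2.2.2) ∧
      SC G (vt p.2.1) (vt p.2.2.1) (vt p.2.2.2.1) (vt p.2.2.2.2)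

instance (G : SimpleGraph (Option (Option (Option (Option (Fin 4)))))) [DecidableRel G.Adj] :
    Decidable (HasCert G) := by unfold HasCert; infer_instance

lemma check_ne : ∀ x1 y1 x2 y2 : Option (Fin 4), K4plus.Adj x1 y1 → K4plus.Adj x2 y2 →
    ¬ ((x1 = x2 ∧ y1 = y2) ∨ (x1 = y2 ∧ y1 = x2)) →
    HasCert (addApex (subdivide (subdivide K4plus x1 y1) (some x2) (some y2))
        {some (some none), some none, none}) := by
  decide +kernel

lemma check_eq : ∀ x1 y1 : Option (Fin 4), K4plus.Adj x1 y1 →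
    HasCert (addApex (subdivide (subdivide K4plus x1 y1) none (some y1))
        {some (some none), some none, none}) := by
  decide +kernel

lemma check_k4p : ∀ x y : Option (Fin 4), K4plus.Adj x y →
    ∃ a b c d : Option (Option (Fin 4)), SC (subdivide K4plus x y) a b c d := by
  decide +kernel

lemma twoSC_of_cert {G : SimpleGraph (Option (Option (Option (Option (Fin 4)))))}
    (h : HasCert G) : TwoSC G := by
  obtain ⟨p, hp, h1, h2⟩ := h
  have hd := certs_disj p hp
  refine ⟨vt '' {u | u = p.1.1 ∨ u = p.1.2.1 ∨ u = p.1.2.2.1 ∨ u = p.1.2.2.2},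
    vt '' {u | u = p.2.1 ∨ u = p.2.2.1 ∨ u = p.2.2.2.1 ∨ u = p.2.2.2.2},
    (Set.disjoint_image_iff vt_inj).2 (Set.disjoint_left.2 fun u h h' => hd u h h'),
    ⟨_, _, _, _, h1, ?_⟩, ⟨_, _, _, _, h2, ?_⟩⟩
  all_goals
    refine ⟨⟨_, ?_, rfl⟩, ⟨_, ?_, rfl⟩, ⟨_, ?_, rfl⟩, ⟨_, ?_, rfl⟩⟩ <;> simp

lemma memF11 {G : SimpleGraph V} (h : MemF 1 1 G) : Nonempty (G ≃g (⊤ : SimpleGraph (Fin 4))) := by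
  cases h with
  | k4 h => exact h
  | circ hj => omega
  | subd hj hH => have := (Inv.of_memF hH).le; omega

lemma perm4 : ∀ p q : Fin 4, p ≠ q → ∃ e : Equiv.Perm (Fin 4), e p = 0 ∧ e q = 1 := by
  decide +kernel

lemma sub_k4 {H : SimpleGraph V} (h : MemF 1 1 H) {x y : V} (hxy : H.Adj x y) :
    Nonempty (subdivide H x y ≃g K4plus) := by
  obtain ⟨f⟩ := memF11 h
  obtain ⟨e, h0, h1⟩ := perm4 (f x) (f y) (f.injective.ne hxy.ne)
  let g : (⊤ : SimpleGraph (Fin 4)) ≃g (⊤ : SimpleGraph (Fin 4)) := ⟨e, by simp⟩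
  have F := subIso (f.trans g) x y
  have hx : (f.trans g) x = 0 := h0
  have hy : (f.trans g) y = 1 := h1
  rw [hx, hy] at F
  exact ⟨F⟩

lemma memF21 {G : SimpleGraph V} (h : MemF 2 1 G) : Nonempty (G ≃g K4plus) := by
  cases h with
  | subd hj hH hxy hG =>
    obtain ⟨f⟩ := hG
    obtain ⟨g⟩ := sub_k4 hH hxy
    exact ⟨f.trans g⟩

lemma memF22 {G : SimpleGraph V} (h : MemF 2 2 G) : TwoSC G := by
  cases h with
  | subd hj hH => have := (Inv.of_memF hH).le; omega
  | @circ _ hj V H hH x y hxy e1 e2 he1 he2 W G hG =>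
    obtain ⟨g⟩ := sub_k4 hH hxy
    have hgn : g none = none := by
      have h2 := dg_iso g none
      have := (Inv.of_memF hH).fin
      rw [dg_sub_none hxy] at h2
      rcases hz : g none with _ | z
      · rfl
      · rw [hz, K4plus, dg_sub_some (by simp)] at h2
        have h3 := (Inv.of_memF (MemF.k4 (G := (⊤ : SimpleGraph (Fin 4))) ⟨Iso.refl⟩))
        have := cubic_of_dfc h3.deg (by rw [h3.dfc]; simp) z
        omega
    rcases hG with ⟨hne, x1, y1, x2, y2, rfl, rfl, ⟨f⟩⟩ | ⟨rfl, x1, y1, rfl, ⟨f⟩⟩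
    · rw [mem_edgeSet] at he1 he2
      have F1 := subIso g x1 y1
      have F := f.trans (apexIso (subIso (subIso g x1 y1) (some x2) (some y2))
        {some (some none), some none, none})
      have hS : (subIso (subIso g x1 y1) (some x2) (some y2)) '' {some (some none), some none, none}
          = {some (some none), some none, none} := by
        rw [Set.image_insert_eq, Set.image_pair]
        change {some (some (g none)), some none, none} = _
        rw [hgn]
      rw [hS] at F
      have := twoSC_of_cert (check_ne (g x1) (g y1) (g x2) (g y2) (g.map_adj_iff.2 he1)
        (g.map_adj_iff.2 he2) (by
          intro h
          apply hne
          simpa using h))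
      exact this.map F.symm F.symm.injective (fun u v => F.symm.map_rel_iff.2)
    · rw [mem_edgeSet] at he1
      have F1 := subIso g x1 y1
      have F := f.trans (apexIso (subIso (subIso g x1 y1) none (some y1))
        {some (some none), some none, none})
      have hS : (subIso (subIso g x1 y1) none (some y1)) '' {some (some none), some none, none}
          = {some (some none), some none, none} := by
        rw [Set.image_insert_eq, Set.image_pair]
        change {some (some (g none)), some none, none} = _
        rw [hgn]
      rw [hS] at F
      have := twoSC_of_cert (check_eq (g x1) (g y1) (g.map_adj_iff.2 he1))
      exact this.map F.symm F.symm.injective (fun u v => F.symm.map_rel_iff.2)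

lemma memF3 {G : SimpleGraph V} {j : ℕ} (hj : j ≤ 2) (h : MemF 3 j G) : ShortIn G Set.univ := by
  suffices h : ∃ a b c d, SC G a b c d by
    obtain ⟨a, b, c, d, h⟩ := h
    exact ⟨a, b, c, d, h, trivial, trivial, trivial, trivial⟩
  cases h with
  | cycle hi h =>
    obtain ⟨f⟩ := h
    have hc : SC (cyc 3) 0 1 2 2 := by
      simp [SC, cyc]
      decide
    exact ⟨_, _, _, _, hc.map f.symm f.symm.injective (fun u v => f.symm.map_adj_iff.2)⟩
  | circ => omega
  | @subd _ _ hj' V H hH x y hxy W G hG =>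
    obtain ⟨f⟩ := hG
    suffices h : ∃ a b c d, SC (subdivide H x y) a b c d by
      obtain ⟨a, b, c, d, h⟩ := h
      exact ⟨_, _, _, _, h.map f.symm f.symm.injective (fun u v => f.symm.map_adj_iff.2)⟩
    obtain rfl | rfl : j = 1 ∨ j = 2 := by omega
    · obtain ⟨g⟩ := memF21 hH
      obtain ⟨a, b, c, d, h⟩ := check_k4p (g x) (g y) (g.map_adj_iff.2 hxy)
      have F := subIso g x y
      exact ⟨_, _, _, _, h.map F.symm F.symm.injective (fun u v => F.symm.map_adj_iff.2)⟩
    · have key : ∀ S, ShortIn H S → x ∉ S → ∃ a b c d, SC (subdivide H x y) a b c d := by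
        rintro S ⟨a, b, c, d, ⟨h1, h2, h3, h4, h5, h6⟩, ha, hb, hc, hd⟩ hx
        refine ⟨some a, some b, some c, some d, ?_⟩
        have hh : ∀ u v, u ∈ S → v ∈ S → H.Adj u v → (subdivide H x y).Adj (some u) (some v) := by
          intro u v hu hv h
          rw [sub_ss]
          refine ⟨h, ?_⟩
          intro h'
          have : x ∈ s(u, v) := by rw [h']; simp
          rw [Sym2.mem_iff] at this
          rcases this with rfl | rfl <;> exact hx (by assumption)
        exact ⟨hh _ _ ha hb h1, hh _ _ hb hc h2, h3.imp (congrArg _) (hh _ _ hc hd),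
          hh _ _ hd ha h4, by simpa using h5, by simpa using h6⟩
      obtain ⟨S, T, hd, hS, hT⟩ := memF22 hH
      by_cases hx : x ∈ S
      · exact key T hT (Set.disjoint_left.1 hd hx)
      · exact key S hS hx

end Part2

section Part3

variable {V W : Type}

lemma memF_iso {i j : ℕ} {G : SimpleGraph V} {K : SimpleGraph W} (h : MemF i j G) (f : K ≃g G) :
    MemF i j K := by
  cases h with
  | cycle hi h => exact .cycle hi ⟨f.trans h.some⟩
  | k4 h => exact .k4 ⟨f.trans h.some⟩
  | circ hj hH hxy he1 he2 hG =>
    refine .circ hj hH hxy he1 he2 ?_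
    rcases hG with ⟨hne, x1, y1, x2, y2, h1, h2, ⟨g⟩⟩ | ⟨h0, x1, y1, h1, ⟨g⟩⟩
    · exact Or.inl ⟨hne, x1, y1, x2, y2, h1, h2, ⟨f.trans g⟩⟩
    · exact Or.inr ⟨h0, x1, y1, h1, ⟨f.trans g⟩⟩
  | subd hj hH hxy hG => exact .subd hj hH hxy ⟨f.trans hG.some⟩

/-- isomorphism of induced subgraphs along a preimage -/
def preIso {H : SimpleGraph V} (f : W ≃ V) (S : Set V) :
    ((H.comap f).induce (f ⁻¹' S)) ≃g H.induce S where
  toEquiv := f.subtypeEquiv (fun _ => Iff.rfl)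
  map_rel_iff' := by
    intro a b
    simp

lemma twoConn_iso {G : SimpleGraph V} {K : SimpleGraph W} (h : TwoConnected G) (f : K ≃g G) :
    TwoConnected K := by
  refine ⟨by rw [Nat.card_congr f.toEquiv]; exact h.1, fun s hs => ?_⟩
  have h1 := h.2 (f '' s) (by rwa [Set.ncard_image_of_injective _ f.injective])
  have e : K.induce sᶜ ≃g G.induce (f '' s)ᶜ :=
    { toEquiv := f.toEquiv.subtypeEquiv (fun a => by
        simp only [Set.mem_compl_iff]
        exact not_congr (f.injective.mem_set_image).symm)
      map_rel_iff' := by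
        intro a b
        exact f.map_adj_iff }
  exact e.connected_iff.2 h1

lemma memFG_iso {i j k : ℕ} {G : SimpleGraph V} {K : SimpleGraph W} (h : MemFG 5 i j k G)
    (f : K ≃g G) : MemFG 5 i j k K := by
  obtain ⟨h1, h2, P, H, hle, hP, h0, hl, hc, hx⟩ := h
  have hK : K = G.comap f.toEquiv := by
    ext u v
    exact f.map_adj_iff.symm
  refine ⟨twoConn_iso h1 f, ?_, P ∘ f, H.comap f.toEquiv, ?_, ?_, ?_, ?_, ?_, ?_⟩
  · intro v
    have := dg_iso f v
    unfold dg at this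
    rw [← this]; exact h2 _
  · intro u v huv
    exact f.map_adj_iff.1 (hle huv)
  · intro u v huv
    exact hP _ _ huv
  · exact memF_iso h0 (preIso f.toEquiv (P ⁻¹' {0}))
  · refine hl.imp (fun h => by omega) (fun h => ⟨h.1, fun l hl0 => ?_⟩)
    exact ⟨(preIso f.toEquiv (P ⁻¹' {l})).trans (h.2 l hl0).some⟩
  · rw [← hc, ← Set.ncard_image_of_injective (f := Sym2.map f.toEquiv) _ 
      (Sym2.map.injective f.toEquiv.injective)]
    congr 1
    ext e
    constructor
    · rintro ⟨e, he, rfl⟩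
      induction e with | _ u v =>
      simp only [Set.mem_sdiff, mem_edgeSet, Sym2.map_mk, comap_adj] at he ⊢
      exact ⟨f.map_adj_iff.2 he.1, he.2⟩
    · intro he
      induction e with | _ u v =>
      refine ⟨s(f.symm u, f.symm v), ?_, ?_⟩
      · simp only [Set.mem_sdiff, mem_edgeSet, comap_adj] at he ⊢
        refine ⟨f.symm.map_adj_iff.2 he.1, ?_⟩
        have hh : ∀ w, f.toEquiv (f.symm w) = w := fun w => f.apply_symm_apply w
        rw [hh, hh]; exact he.2
      · have hh : ∀ w, f.toEquiv (f.symm w) = w := fun w => f.apply_symm_apply w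
        rw [Sym2.map_mk, hh, hh]
  · intro hk u v huv hn
    exact hx hk _ _ (f.map_adj_iff.2 huv) hn

lemma sum_dg [Fintype V] (G : SimpleGraph V) : ∑ v, dg G v = 2 * G.edgeSet.ncard := by
  classical
  rw [Set.ncard_eq_toFinset_card', Set.toFinset_card, ← edgeFinset_card,
    ← sum_degrees_eq_twice_card_edges]
  refine Finset.sum_congr rfl fun v _ => ?_
  unfold dg
  rw [Set.ncard_eq_toFinset_card', Set.toFinset_card, card_neighborSet_eq_degree]

lemma dfc_edges [Fintype V] (G : SimpleGraph V) :
    dfc G = 3 * Fintype.card V - 2 * G.edgeSet.ncard := by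
  unfold dfc
  rw [finsum_eq_sum_of_fintype, Finset.sum_sub_distrib, ← Nat.cast_sum, sum_dg]
  simp
  ring

instance petDec : DecidableRel petersen.Adj := by unfold petersen; infer_instance

lemma dg_R (v : ZMod 5 × Fin 2) : dg Rgraph v = if v = (0, 0) ∨ v = (1, 0) then 2 else 3 := by
  have : Rgraph.neighborSet v =
      ((Finset.univ.filter fun w => petersen.Adj v w ∧
        ¬ ((v = (0, 0) ∧ w = (1, 0)) ∨ (v = (1, 0) ∧ w = (0, 0))) : 
        Finset (ZMod 5 × Fin 2)) : Set _) := by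
    ext w
    simp [Rgraph, deleteEdges_adj]
  unfold dg
  rw [this, Set.ncard_coe_finset]
  clear this
  revert v
  decide +kernel

lemma dfc_R : dfc Rgraph = 2 := by
  unfold dfc
  rw [finsum_eq_sum_of_fintype]
  simp only [dg_R]
  decide +kernel

lemma dfc_parts [Finite V] {m : ℕ} (H : SimpleGraph V) (P : V → Fin m)
    (hP : ∀ u v, H.Adj u v → P u = P v) :
    dfc H = ∑ l, dfc (H.induce (P ⁻¹' {l})) := by
  classical
  have := Fintype.ofFinite V
  have hd : ∀ l (v : ↥(P ⁻¹' {l})), dg (H.induce (P ⁻¹' {l})) v = dg H v := by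
    rintro l ⟨v, hv⟩
    unfold dg
    rw [← Set.ncard_image_of_injective _ Subtype.val_injective]
    congr 1
    ext w
    simp only [Set.mem_image, mem_neighborSet, comap_adj]
    constructor
    · rintro ⟨w, hw, rfl⟩; exact hw
    · intro hw
      exact ⟨⟨w, by rw [Set.mem_preimage, ← hP _ _ hw]; exact hv⟩, hw, rfl⟩
  unfold dfc
  simp only [finsum_eq_sum_of_fintype, hd]
  rw [← Finset.sum_fiberwise Finset.univ P]
  refine Finset.sum_congr rfl fun l _ => ?_
  exact Finset.sum_subtype _ (p := fun x => x ∈ P ⁻¹' {l}) (fun x => by simp) _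

lemma memFG_dfc [Finite V] {i j k : ℕ} {G : SimpleGraph V} (h : MemFG 5 i j k G) :
    dfc G = i - j - 2 := by
  obtain ⟨h1, h2, P, H, hle, hP, h0, hl, hc, hx⟩ := h
  have := Fintype.ofFinite V
  have e1 := dfc_edges G
  have e2 := dfc_edges H
  have e3 := dfc_parts H P hP
  rw [Fin.sum_univ_succ, (Inv.of_memF h0).dfc] at e3
  obtain ⟨_, hl⟩ : _ ∧ _ := hl.resolve_left (by omega)
  rw [Finset.sum_congr rfl (g := fun _ => (2 : ℤ)) (fun l _ => by
    rw [dfc_iso (hl l.succ (Fin.succ_ne_zero l)).some, dfc_R])] at e3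
  simp only [Finset.sum_const, Finset.card_univ, Fintype.card_fin, nsmul_eq_mul] at e3
  have hsub : H.edgeSet ⊆ G.edgeSet := edgeSet_mono hle
  have e4 := Set.ncard_sdiff_add_ncard_of_subset hsub (Set.toFinite _)
  rw [hc] at e4
  have e5 : ((G.edgeSet.ncard : ℕ) : ℤ) = k + 1 + H.edgeSet.ncard := by
    rw [← e4]; push_cast; ring
  rw [e1, e5]
  linarith

lemma dfc_nonneg [Finite V] {G : SimpleGraph V} (h : ∀ v, dg G v ≤ 3) : 0 ≤ dfc G := by
  apply finsum_nonneg
  intro v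
  have := h v
  omega

lemma memF0 {i : ℕ} {G : SimpleGraph V} (h : MemF i 0 G) : 3 ≤ i := by
  cases h with
  | cycle hi h => exact hi
  | circ hj => omega
  | subd hj => omega

lemma memFG_bounds [Finite V] {i j k : ℕ} {G : SimpleGraph V} (h : MemFG 5 i j k G) :
    3 ≤ i ∧ j + 2 ≤ i := by
  have h1 := memFG_dfc h
  have h2 := dfc_nonneg (G := G) h.2.1
  have h3 : j + 2 ≤ i := by omega
  refine ⟨?_, h3⟩
  obtain ⟨_, _, P, H, hle, hP, h0, _⟩ := h
  rcases Nat.eq_zero_or_pos j with rfl | hj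
  · exact memF0 h0
  · omega

lemma memFG_short {k : ℕ} {G : SimpleGraph V} (h : MemFG 5 3 0 k G) : ShortIn G Set.univ := by
  obtain ⟨_, _, P, H, hle, hP, h0, _⟩ := h
  exact ((memF3 (by norm_num) h0).map Subtype.val Subtype.val_injective
    (fun u v huv => hle huv)).mono (Set.subset_univ _)

lemma memFG_cubic [Finite V] {k : ℕ} {G : SimpleGraph V} (h : MemFG 5 3 1 k G) (v : V) :
    dg G v = 3 :=
  cubic_of_dfc h.2.1 (by rw [memFG_dfc h]; norm_num) v

lemma memF_cubic {j : ℕ} {G : SimpleGraph V} (h : MemF j j G) (v : V) : dg G v = 3 := by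
  have := Inv.of_memF h
  have := this.fin
  exact cubic_of_dfc (Inv.of_memF h).deg (by rw [(Inv.of_memF h).dfc]; simp) v

lemma eps_spec (G : SimpleGraph V) :
    (∃ i j, MemF i j G ∧ 1 ≤ i ∧ eps 5 G = max (1 - (i : ℝ) / 5) 0) ∨
    (∃ i j k, MemFG 5 i j k G ∧ 1 ≤ i ∧ eps 5 G = max (4 / 5 - (i : ℝ) / 5) 0) ∨
    (eps 5 G = - (1 / 5) ∧ Nonempty (G ≃g (⊤ : SimpleGraph (Fin 2)))) ∨
    (eps 5 G = 0 ∧ ¬ Nonempty (G ≃g (⊤ : SimpleGraph (Fin 2)))) := by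
  have ht : tg 5 = 1 / 5 := by simp [tg]
  unfold eps
  split_ifs with h1 h2 h3
  · left
    refine ⟨h1.choose.1, h1.choose.2, h1.choose_spec.2.2, h1.choose_spec.1, ?_⟩
    rw [ht]; congr 1; ring
  · right; left
    refine ⟨h2.choose.1, h2.choose.2.1, h2.choose.2.2, h2.choose_spec.2.2, h2.choose_spec.1, ?_⟩
    rw [ht]; congr 1; ring
  · right; right; left
    exact ⟨by rw [ht], h3⟩
  · right; right; right
    exact ⟨rfl, h3⟩

lemma max_int (n : ℕ) (c : ℤ) : ∃ z : ℤ, max ((c : ℝ) / 5 - (n : ℝ) / 5) 0 = z / 5 := by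
  refine ⟨max (c - n) 0, ?_⟩
  push_cast
  rcases le_total ((c : ℝ) - n) 0 with h | h
  · rw [max_eq_right h, max_eq_right (by linarith)]; simp
  · rw [max_eq_left h, max_eq_left (by linarith)]; ring

lemma eps_int (G : SimpleGraph V) : ∃ z : ℤ, eps 5 G = z / 5 := by
  rcases eps_spec G with ⟨i, j, _, _, h⟩ | ⟨i, j, k, _, _, h⟩ | ⟨h, _⟩ | ⟨h, _⟩
  · obtain ⟨z, hz⟩ := max_int i 5
    exact ⟨z, by rw [h, ← hz]; norm_num⟩
  · obtain ⟨z, hz⟩ := max_int i 4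
    exact ⟨z, by rw [h, ← hz]; norm_num⟩
  · exact ⟨-1, by rw [h]; norm_num⟩
  · exact ⟨0, by rw [h]; norm_num⟩

lemma eps_big [Finite V] (G : SimpleGraph V) :
    MemF 1 1 G ∨ MemF 2 1 G ∨ MemF 2 2 G ∨
    (eps 5 G = 2 / 5 ∧ ∃ j ≤ 3, MemF 3 j G) ∨
    (eps 5 G = 1 / 5 ∧ ((∃ j ≤ 4, MemF 4 j G) ∨ (∃ k, MemFG 5 3 0 k G) ∨ ∃ k, MemFG 5 3 1 k G)) ∨
    eps 5 G ≤ 0 := by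
  rcases eps_spec G with ⟨i, j, hF, hi, h⟩ | ⟨i, j, k, hF, hi, h⟩ | ⟨h, _⟩ | ⟨h, _⟩
  · have hle := (Inv.of_memF hF).le
    have h0 : j = 0 → 3 ≤ i := by rintro rfl; exact memF0 hF
    by_cases h5 : 5 ≤ i
    · right; right; right; right; right
      rw [h, max_eq_right]
      have : (5 : ℝ) ≤ i := by exact_mod_cast h5
      linarith
    · have : i = 1 ∨ i = 2 ∨ i = 3 ∨ i = 4 := by omega
      rcases this with rfl | rfl | rfl | rfl
      · obtain rfl : j = 1 := by omega
        exact Or.inl hF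
      · obtain rfl | rfl : j = 1 ∨ j = 2 := by omega
        · exact Or.inr (Or.inl hF)
        · exact Or.inr (Or.inr (Or.inl hF))
      · refine Or.inr (Or.inr (Or.inr (Or.inl ⟨?_, j, hle, hF⟩)))
        rw [h]; norm_num
      · refine Or.inr (Or.inr (Or.inr (Or.inr (Or.inl ⟨?_, Or.inl ⟨j, hle, hF⟩⟩))))
        rw [h]; norm_num
  · have hb := memFG_bounds hF
    by_cases h4 : 4 ≤ i
    · right; right; right; right; right
      rw [h, max_eq_right]
      have : (4 : ℝ) ≤ i := by exact_mod_cast h4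
      linarith
    · obtain rfl : i = 3 := by omega
      refine Or.inr (Or.inr (Or.inr (Or.inr (Or.inl ⟨by rw [h]; norm_num, Or.inr ?_⟩))))
      obtain rfl | rfl : j = 0 ∨ j = 1 := by omega
      · exact Or.inl ⟨k, hF⟩
      · exact Or.inr ⟨k, hF⟩
  · right; right; right; right; right
    rw [h]; norm_num
  · right; right; right; right; right
    rw [h]

lemma eps_small (G : SimpleGraph V) (hc : Nat.card V < 3) : eps 5 G ≤ 0 := by
  rcases eps_spec G with ⟨i, j, hF, hi, h⟩ | ⟨i, j, k, hF, hi, h⟩ | ⟨h, _⟩ | ⟨h, _⟩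
  · have := (Inv.of_memF hF).card; omega
  · have := hF.1.1; omega
  · rw [h]; norm_num
  · rw [h]

lemma eps_two (G : SimpleGraph V) (hG : G.Connected) (hc : Nat.card V = 2) :
    eps 5 G = - (1 / 5) := by
  rcases eps_spec G with ⟨i, j, hF, hi, h⟩ | ⟨i, j, k, hF, hi, h⟩ | ⟨h, _⟩ | ⟨_, h⟩
  · have := (Inv.of_memF hF).card; omega
  · have := hF.1.1; omega
  · exact h
  · exfalso
    apply h
    have : Finite V := Nat.finite_of_card_ne_zero (by omega)
    have e : V ≃ Fin 2 := Finite.equivFinOfCardEq hc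
    have htop : G = ⊤ := by
      ext u v
      simp only [top_adj]
      refine ⟨fun h => h.ne, fun huv => ?_⟩
      have : Nontrivial V := ⟨u, v, huv⟩
      obtain ⟨w, hw⟩ := hG.preconnected.exists_adj_of_nontrivial u
      have : w = v := by
        by_contra hwv
        have h1 := hw.ne
        have : ({u, v, w} : Set V).ncard = 3 := by
          rw [Set.ncard_eq_three]; exact ⟨u, v, w, huv, h1, Ne.symm hwv, rfl⟩
        have h2 := Set.ncard_le_card ({u, v, w} : Set V)
        omega
      rwa [← this]
    subst htop
    exact ⟨⟨e, by simp⟩⟩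

end Part3

section Part4

variable {V W : Type}

/-- nonseparable sets -/
def NS (G : SimpleGraph V) (B : Set V) : Prop :=
  (G.induce B).Connected ∧ ∀ v ∈ B, (G.induce (B \ {v})).Preconnected

/-- removing a vertex from an induced subgraph -/
def delIso (G : SimpleGraph V) (B : Set V) (v : B) :
    (G.induce B).induce {u | u ≠ v} ≃g G.induce (B \ {v.1}) where
  toFun u := ⟨u.1.1, u.1.2, fun h => u.2 (Subtype.ext h)⟩
  invFun u := ⟨⟨u.1, u.2.1⟩, fun h => u.2.2 (congrArg Subtype.val h)⟩
  left_inv _ := rfl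
  right_inv _ := rfl
  map_rel_iff' := Iff.rfl

lemma precon_iff_card [Finite V] (K : SimpleGraph V) :
    K.Preconnected ↔ Nat.card K.ConnectedComponent ≤ 1 := by
  rw [Finite.card_le_one_iff_subsingleton]
  constructor
  · intro h; exact h.subsingleton_connectedComponent
  · intro h u v
    exact ConnectedComponent.eq.1 (Subsingleton.elim _ _)

lemma ns_iff [Finite V] (G : SimpleGraph V) (B : Set V) :
    ((G.induce B).Connected ∧ ∀ v, ¬ IsCutVertex (G.induce B) v) ↔ NS G B := by
  refine and_congr_right fun hc => ?_
  have h1 : Nat.card (G.induce B).ConnectedComponent = 1 := by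
    apply le_antisymm ((precon_iff_card _).1 hc.preconnected)
    have := hc.nonempty
    exact Nat.card_pos
  simp only [IsCutVertex, h1, not_lt, Subtype.forall]
  refine forall_congr' fun v => forall_congr' fun hv => ?_
  rw [← precon_iff_card]
  exact (delIso G B ⟨v, hv⟩).preconnected_iff

lemma block_iff [Finite V] (G : SimpleGraph V) (B : Set V) :
    IsBlock G B ↔ NS G B ∧ ∀ B', B ⊆ B' → NS G B' → B' = B := by
  unfold IsBlock
  simp only [ns_iff]

lemma NS.union {G : SimpleGraph V} {A B : Set V} (hA : NS G A) (hB : NS G B) {u v : V}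
    (hu : u ∈ A ∩ B) (hv : v ∈ A ∩ B) (huv : u ≠ v) : NS G (A ∪ B) := by
  refine ⟨induce_union_connected hA.1.preconnected hB.1.preconnected ⟨u, hu⟩, fun w _ => ?_⟩
  have key : ∀ C, NS G C → (G.induce (C \ {w})).Preconnected := by
    intro C hC
    by_cases hw : w ∈ C
    · exact hC.2 w hw
    · rw [Set.sdiff_singleton_eq_self hw]; exact hC.1.preconnected
  rw [Set.union_sdiff_distrib]
  refine (induce_union_connected (key A hA) (key B hB) ?_).preconnected
  by_cases h : u = w
  · exact ⟨v, ⟨hv.1, fun h' => huv (h.trans h'.symm)⟩, ⟨hv.2, fun h' => huv (h.trans h'.symm)⟩⟩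
  · exact ⟨u, ⟨hu.1, h⟩, ⟨hu.2, h⟩⟩

lemma exists_nbr {G : SimpleGraph V} {B : Set V} (hB : (G.induce B).Preconnected) {v w : V}
    (hv : v ∈ B) (hw : w ∈ B) (h : v ≠ w) : ∃ u ∈ B, G.Adj v u := by
  have : Nontrivial B := ⟨⟨v, hv⟩, ⟨w, hw⟩, by simpa using h⟩
  obtain ⟨u, hu⟩ := hB.exists_adj_of_nontrivial ⟨v, hv⟩
  exact ⟨u.1, u.2, hu⟩

lemma exists_third [Finite V] {B : Set V} (h : 3 ≤ B.ncard) (u v : V) :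
    ∃ w ∈ B, w ≠ u ∧ w ≠ v := by
  by_contra hc
  push Not at hc
  have : B ⊆ {u, v} := by
    intro w hw
    by_cases h1 : w = u
    · exact Or.inl h1
    · exact Or.inr (hc w hw h1)
  have h2 := Set.ncard_le_ncard this (Set.toFinite _)
  have h3 := Set.ncard_insert_le u {v}
  rw [Set.ncard_singleton] at h3
  omega

lemma NS.two_nbrs [Finite V] {G : SimpleGraph V} {B : Set V} (hB : NS G B) (h3 : 3 ≤ B.ncard)
    {v : V} (hv : v ∈ B) : 2 ≤ (G.neighborSet v ∩ B).ncard := by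
  obtain ⟨w, hw, hwv, _⟩ := exists_third h3 v v
  obtain ⟨u, hu, huv⟩ := exists_nbr hB.1.preconnected hv hw hwv.symm
  obtain ⟨w', hw', hwv', hwu'⟩ := exists_third h3 v u
  obtain ⟨u', hu', huv'⟩ := exists_nbr (hB.2 u hu) (v := v) (w := w')
    ⟨hv, huv.ne⟩ ⟨hw', hwu'⟩ hwv'.symm
  have hne : u ≠ u' := fun h => hu'.2 h.symm
  rw [← Set.ncard_pair hne]
  apply Set.ncard_le_ncard _ (Set.toFinite _)
  rintro z (rfl | rfl)
  · exact ⟨huv, hu⟩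
  · exact ⟨huv', hu'.1⟩

lemma block_eq [Finite V] {G : SimpleGraph V} (hs : Subcubic G) {A B : Set V} (hA : IsBlock G A)
    (hB : IsBlock G B) (hA3 : 3 ≤ A.ncard) (hB3 : 3 ≤ B.ncard) {v : V} (hvA : v ∈ A)
    (hvB : v ∈ B) : A = B := by
  rw [block_iff] at hA hB
  have h1 := hA.1.two_nbrs hA3 hvA
  have h2 := hB.1.two_nbrs hB3 hvB
  have h3 := hs v
  have h4 : ((G.neighborSet v ∩ A) ∩ (G.neighborSet v ∩ B)).Nonempty := by
    rw [Set.nonempty_iff_ne_empty]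
    intro h0
    have h5 := Set.ncard_union_eq (Set.disjoint_iff_inter_eq_empty.2 h0) (Set.toFinite _)
      (Set.toFinite _)
    have h6 : (G.neighborSet v ∩ A) ∪ (G.neighborSet v ∩ B) ⊆ G.neighborSet v := by
      intro z hz; rcases hz with hz | hz <;> exact hz.1
    have h7 := Set.ncard_le_ncard h6 (Set.toFinite _)
    omega
  obtain ⟨u, hu1, hu2⟩ := h4
  have hun := hA.1.union hB.1 ⟨hvA, hvB⟩ ⟨hu1.2, hu2.2⟩ (G.ne_of_adj hu1.1)
  rw [← hA.2 _ Set.subset_union_left hun, hB.2 _ Set.subset_union_right hun]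

lemma NS.exists_block [Finite V] {G : SimpleGraph V} {B : Set V} (hB : NS G B) :
    ∃ B', B ⊆ B' ∧ IsBlock G B' := by
  obtain ⟨B', h1, h2⟩ := (Set.toFinite {B | NS G B}).exists_le_maximal hB
  refine ⟨B', h1, (block_iff G B').2 ⟨h2.prop, fun C hC hN => ?_⟩⟩
  exact (h2.eq_of_le hN hC).symm

lemma NS.pair {G : SimpleGraph V} {u v : V} (h : G.Adj u v) : NS G {u, v} := by
  refine ⟨induce_pair_connected_of_adj h, fun w _ => ?_⟩
  rintro ⟨a, ha⟩ ⟨b, hb⟩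
  have : a = b := by
    obtain ⟨ha1, ha2⟩ := ha
    obtain ⟨hb1, hb2⟩ := hb
    simp at *
    grind
  subst this
  rfl

lemma block_nonempty {G : SimpleGraph V} {B : Set V} (h : IsBlock G B) : B.Nonempty := by
  have := h.1.1.nonempty
  exact Set.nonempty_coe_sort.1 this

lemma block_univ [Finite V] {G : SimpleGraph V} (h : IsBlock G Set.univ) {B : Set V}
    (hB : IsBlock G B) : B = Set.univ := by
  rw [block_iff] at h hB
  exact (hB.2 _ (Set.subset_univ _) h.1).symm

lemma cubic_univ [Finite V] {G : SimpleGraph V} (hG : G.Connected) (hs : Subcubic G) {B : Set V}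
    (hne : B.Nonempty) (hB : ∀ v, dg (G.induce B) v = 3) : B = Set.univ := by
  have hcl : ∀ u v, u ∈ B → G.Adj u v → v ∈ B := by
    intro u v hu huv
    have h1 := hB ⟨u, hu⟩
    unfold dg at h1
    rw [← Set.ncard_image_of_injective _ Subtype.val_injective] at h1
    have hsub : Subtype.val '' ((G.induce B).neighborSet ⟨u, hu⟩) ⊆ G.neighborSet u := by
      rintro _ ⟨w, hw, rfl⟩; exact hw
    have h2 := Set.eq_of_subset_of_ncard_le hsub (by rw [h1]; exact hs u) (Set.toFinite _)
    have h3 : v ∈ G.neighborSet u := huv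
    rw [← h2] at h3
    obtain ⟨w, _, rfl⟩ := h3
    exact w.2
  obtain ⟨u, hu⟩ := hne
  ext v
  simp only [Set.mem_univ, iff_true]
  obtain ⟨p⟩ := hG.preconnected u v
  induction p with
  | nil => exact hu
  | cons h p ih => exact ih (hcl _ _ hu h)

/-- Crossing-edge count. -/
lemma count_cross [Finite V] {α : Type} (K : SimpleGraph V) (hK : K.Connected) (P : V → α) :
    (Set.range P).ncard ≤ {e | e ∈ K.edgeSet ∧ ¬ (e.map P).IsDiag}.ncard + 1 := by
  classical
  let Q : SimpleGraph (Set.range P) :=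
    { Adj := fun a b => a ≠ b ∧ ∃ u v, K.Adj u v ∧ P u = a ∧ P v = b
      symm := ⟨fun a b => by
        rintro ⟨h, u, v, huv, hu, hv⟩
        exact ⟨h.symm, v, u, huv.symm, hv, hu⟩⟩
      loopless := ⟨fun a h => h.1 rfl⟩ }
  have hQr : ∀ u v, K.Reachable u v → Q.Reachable ⟨P u, u, rfl⟩ ⟨P v, v, rfl⟩ := by
    rintro u v ⟨p⟩
    induction p with
    | nil => rfl
    | @cons a b c h p ih =>
      refine Reachable.trans ?_ ih
      by_cases hab : P a = P b
      · simp only [hab]; rfl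
      · exact Adj.reachable ⟨fun h => hab (congrArg Subtype.val h), a, b, h, rfl, rfl⟩
  have hQ : Q.Connected := by
    have : Nonempty (Set.range P) := by
      obtain ⟨v⟩ := hK.nonempty
      exact ⟨⟨P v, v, rfl⟩⟩
    refine ⟨?_⟩
    rintro ⟨_, u, rfl⟩ ⟨_, v, rfl⟩
    exact hQr u v (hK.preconnected u v)
  have h1 := hQ.card_vert_le_card_edgeSet_add_one
  have h2 : Nat.card Q.edgeSet ≤ {e | e ∈ K.edgeSet ∧ ¬ (e.map P).IsDiag}.ncard := by
    rw [Nat.card_coe_set_eq]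
    rw [← Set.ncard_image_of_injective Q.edgeSet (Sym2.map.injective Subtype.val_injective)]
    refine le_trans (Set.ncard_le_ncard (t := Sym2.map P '' {e | e ∈ K.edgeSet ∧ ¬ (e.map P).IsDiag})
      ?_ (Set.toFinite _)) (Set.ncard_image_le (Set.toFinite _))
    rintro _ ⟨e, he, rfl⟩
    induction e with | _ a b =>
    obtain ⟨hab, u, v, huv, hu, hv⟩ := he
    refine ⟨s(u, v), ⟨huv, ?_⟩, ?_⟩
    · simp only [Sym2.map_mk, Sym2.mk_isDiag_iff, hu, hv]
      exact fun h => hab (Subtype.ext h)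
    · simp [hu, hv]
  rw [Nat.card_coe_set_eq] at h1
  omega

end Part4

section Part5

variable {V : Type}

/-- big blocks -/
def Big (G : SimpleGraph V) (B : Set V) : Prop := IsBlock G B ∧ 3 ≤ B.ncard

open Classical in
/-- the part containing `v` -/
noncomputable def part (G : SimpleGraph V) (v : V) : Set V :=
  if h : ∃ B, Big G B ∧ v ∈ B then h.choose else {v}

lemma part_eq [Finite V] {G : SimpleGraph V} (hs : Subcubic G) {B : Set V} (hB : Big G B) {v : V}
    (hv : v ∈ B) : part G v = B := by
  have h : ∃ B, Big G B ∧ v ∈ B := ⟨B, hB, hv⟩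
  unfold part
  rw [dif_pos h]
  exact block_eq hs h.choose_spec.1.1 hB.1 h.choose_spec.1.2 hB.2 h.choose_spec.2 hv

lemma mem_part (G : SimpleGraph V) (v : V) : v ∈ part G v := by
  unfold part
  split_ifs with h
  · exact h.choose_spec.2
  · rfl

lemma cross_block [Finite V] {G : SimpleGraph V} (hs : Subcubic G) {u v : V} (huv : G.Adj u v)
    (h : part G u ≠ part G v) : IsBlock G {u, v} := by
  obtain ⟨B, hsub, hB⟩ := (NS.pair huv).exists_block
  by_cases h3 : 3 ≤ B.ncard
  · exfalso
    apply h
    rw [part_eq hs ⟨hB, h3⟩ (hsub (by simp)), part_eq hs ⟨hB, h3⟩ (hsub (by simp))]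
  · have : ({u, v} : Set V) = B := by
      apply Set.eq_of_subset_of_ncard_le hsub _ (Set.toFinite _)
      rw [Set.ncard_pair huv.ne]; omega
    rwa [this]

/-- crossing edges of `K` w.r.t. the parts of `G` -/
def cross (G K : SimpleGraph V) : Set (Sym2 V) := {e | e ∈ K.edgeSet ∧ ¬ (e.map (part G)).IsDiag}

/-- blocks of size two -/
def twos (G : SimpleGraph V) : Set (Set V) := {B | IsBlock G B ∧ B.ncard = 2}

lemma cross_le [Finite V] {G : SimpleGraph V} (hs : Subcubic G) :
    (cross G G).ncard ≤ (twos G).ncard := by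
  refine Set.ncard_le_ncard_of_injOn (fun e => {x | x ∈ e}) ?_ ?_ (Set.toFinite _)
  · intro e he
    induction e with | _ u v =>
    obtain ⟨h1, h2⟩ := he
    simp only [Sym2.map_mk, Sym2.mk_isDiag_iff] at h2
    have hset : {x | x ∈ s(u, v)} = ({u, v} : Set V) := by ext x; simp
    rw [hset]
    exact ⟨cross_block hs h1 h2, Set.ncard_pair (G.ne_of_adj h1)⟩
  · intro e _ f _ h
    apply Sym2.ext
    intro x
    exact Set.ext_iff.1 h x

lemma parts_le [Finite V] {G : SimpleGraph V} (hG : G.Connected) (hs : Subcubic G) :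
    (Set.range (part G)).ncard ≤ (twos G).ncard + 1 := by
  have h1 := count_cross G hG (part G)
  have h2 := cross_le hs
  unfold cross at h2
  omega

lemma cross_bridge [Finite V] {G : SimpleGraph V} (hG : G.Connected) (hs : Subcubic G)
    (h : (twos G).ncard + 1 ≤ (Set.range (part G)).ncard) {u v : V} (huv : G.Adj u v)
    (hp : part G u ≠ part G v) : G.IsBridge s(u, v) := by
  by_contra hb
  have h1 := count_cross _ (hG.connected_delete_edge_of_not_isBridge hb) (part G)
  have h2 := cross_le hs
  have h3 : {e | e ∈ (G.deleteEdges {s(u, v)}).edgeSet ∧ ¬ (e.map (part G)).IsDiag}.ncard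
      < (cross G G).ncard := by
    apply Set.ncard_lt_ncard _ (Set.toFinite _)
    refine ⟨?_, ?_⟩
    · rintro e ⟨he, hd⟩
      rw [edgeSet_deleteEdges] at he
      exact ⟨he.1, hd⟩
    · intro hsub
      have : s(u, v) ∈ cross G G := ⟨huv, by simpa using hp⟩
      have := (hsub this).1
      rw [edgeSet_deleteEdges] at this
      exact this.2 rfl
  omega

lemma bigs_le [Finite V] {G : SimpleGraph V} (hs : Subcubic G) :
    {B | Big G B}.ncard ≤ (Set.range (part G)).ncard := by
  apply Set.ncard_le_ncard _ (Set.toFinite _)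
  intro B hB
  obtain ⟨v, hv⟩ := block_nonempty hB.1
  exact ⟨v, part_eq hs hB hv⟩

lemma bigs_cover [Finite V] {G : SimpleGraph V} (hs : Subcubic G)
    (h : (Set.range (part G)).ncard ≤ {B | Big G B}.ncard) (v : V) : Big G (part G v) := by
  have h1 : {B | Big G B} ⊆ Set.range (part G) := by
    intro B hB
    obtain ⟨v, hv⟩ := block_nonempty hB.1
    exact ⟨v, part_eq hs hB hv⟩
  have h2 := Set.eq_of_subset_of_ncard_le h1 h (Set.toFinite _)
  have h3 : part G v ∈ Set.range (part G) := ⟨v, rfl⟩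
  rwa [← h2] at h3

/-- sum of eps over big blocks -/
noncomputable def bigSum (G : SimpleGraph V) : ℝ := ∑ᶠ B ∈ {B | Big G B}, eps 5 (G.induce B)

lemma rg_le [Finite V] (G : SimpleGraph V) : rg 5 G ≤ bigSum G - (twos G).ncard / 5 := by
  classical
  have hfin : {B | IsBlock G B}.Finite := Set.toFinite _
  have hfb : {B | Big G B}.Finite := Set.toFinite _
  have hft : (twos G).Finite := Set.toFinite _
  unfold rg bigSum
  rw [finsum_mem_eq_finite_toFinset_sum _ hfin, finsum_mem_eq_finite_toFinset_sum _ hfb]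
  have e1 : hfb.toFinset = hfin.toFinset.filter (fun B => 3 ≤ B.ncard) := by
    ext B; simp [Big]
  have e2 : hft.toFinset = hfin.toFinset.filter (fun B => B.ncard = 2) := by
    ext B; simp [twos]
  rw [Set.ncard_eq_toFinset_card _ hft, e1, e2, Finset.sum_filter, Finset.card_filter]
  push_cast
  rw [Finset.sum_div, ← Finset.sum_sub_distrib]
  apply Finset.sum_le_sum
  intro B hB
  rw [Set.Finite.mem_toFinset] at hB
  have hc : Nat.card B = B.ncard := Nat.card_coe_set_eq B
  by_cases h3 : 3 ≤ B.ncard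
  · rw [if_pos h3, if_neg (by omega)]; simp
  · rw [if_neg h3]
    split_ifs with h2
    · rw [eps_two _ hB.1.1 (by omega)]; simp
    · have := eps_small (G.induce B) (by omega)
      simpa using this

lemma rg_int [Finite V] (G : SimpleGraph V) : ∃ z : ℤ, rg 5 G = z / 5 := by
  classical
  have hfin : {B | IsBlock G B}.Finite := Set.toFinite _
  choose z hz using fun B : Set V => eps_int (G.induce B)
  unfold rg
  rw [finsum_mem_eq_finite_toFinset_sum _ hfin]
  refine ⟨∑ B ∈ hfin.toFinset, z B, ?_⟩
  simp only [hz]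
  push_cast
  rw [Finset.sum_div]

/-- the graph of edges within classes -/
def inner {κ : Type} (G : SimpleGraph V) (P : V → κ) : SimpleGraph V where
  Adj u v := G.Adj u v ∧ P u = P v
  symm := ⟨fun _ _ h => ⟨h.1.symm, h.2.symm⟩⟩
  loopless := ⟨fun _ h => G.loopless.irrefl _ h.1⟩

lemma inner_induce {κ : Type} (G : SimpleGraph V) (P : V → κ) (i : κ) :
    (inner G P).induce (P ⁻¹' {i}) = G.induce (P ⁻¹' {i}) := by
  ext ⟨u, hu⟩ ⟨v, hv⟩
  simp only [inner, comap_adj, Function.Embedding.subtype_apply]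
  refine and_iff_left ?_
  rw [show P u = i from hu, show P v = i from hv]

lemma inner_cut [Finite V] {κ : Type} {G : SimpleGraph V} (hG : G.Connected) (hs : Subcubic G)
    (h : (twos G).ncard + 1 ≤ (Set.range (part G)).ncard) {P : V → κ}
    (hP : ∀ u v, part G u = part G v → P u = P v) : AddCutEdges (inner G P) G := by
  refine ⟨fun u v h => h.1, fun e he => ?_⟩
  induction e with | _ u v =>
  refine cross_bridge hG hs h he.1 fun hp => he.2 ⟨he.1, hP _ _ hp⟩

lemma big_class [Finite V] {G : SimpleGraph V} (hG : G.Connected) (hs : Subcubic G)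
    (h : ¬ TwoDisjointCyclesLt G 5)
    (h1 : ¬ (Nonempty (G ≃g (⊤ : SimpleGraph (Fin 4))) ∨ ContainsSubgraphCopy K4plus G))
    (B : Set V) (hB : B.Nonempty) :
    (eps 5 (G.induce B) = 2 / 5 ∧ ∃ j ≤ 3, MemF 3 j (G.induce B)) ∨
    (eps 5 (G.induce B) = 1 / 5 ∧ ((∃ j ≤ 4, MemF 4 j (G.induce B)) ∨
      (∃ k, MemFG 5 3 0 k (G.induce B)) ∨ ∃ k, MemFG 5 3 1 k (G.induce B))) ∨
    eps 5 (G.induce B) ≤ 0 := by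
  rcases eps_big (G.induce B) with hF | hF | hF | hF
  · exfalso
    have hu := cubic_univ hG hs hB (memF_cubic hF)
    subst hu
    obtain ⟨f⟩ := memF11 hF
    exact h1 (Or.inl ⟨(induceUnivIso G).symm.trans f⟩)
  · exfalso
    obtain ⟨f⟩ := memF21 hF
    exact h1 (Or.inr ⟨fun u => (f.symm u).1, Subtype.val_injective.comp f.symm.injective,
      fun u v huv => (f.symm.map_adj_iff.2 huv :)⟩)
  · exact absurd ((memF22 hF).map Subtype.val Subtype.val_injective (fun _ _ h => h)).two h
  · exact hF

lemma short_val {G : SimpleGraph V} {B : Set V} (h : ShortIn (G.induce B) Set.univ) :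
    ShortIn G B := by
  refine (h.map (K := G) Subtype.val Subtype.val_injective (fun _ _ h => h)).mono ?_
  rintro _ ⟨x, _, rfl⟩; exact x.2

lemma big_disjoint [Finite V] {G : SimpleGraph V} (hs : Subcubic G) {A B : Set V} (hA : Big G A)
    (hB : Big G B) (hne : A ≠ B) : Disjoint A B := by
  rw [Set.disjoint_left]
  intro v hv hv'
  exact hne (block_eq hs hA.1 hB.1 hA.2 hB.2 hv hv')

/-- two distinct big blocks cannot both be `A ∈ F_{3,j}` and contain a short cycle -/
lemma big_short [Finite V] {G : SimpleGraph V} (hG : G.Connected) (hs : Subcubic G)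
    (h : ¬ TwoDisjointCyclesLt G 5) {A B : Set V} (hA : Big G A)
    (hB : Big G B) (hne : A ≠ B) {j : ℕ} (hj : j ≤ 3) (hF : MemF 3 j (G.induce A)) :
    j ≤ 2 ∧ B ≠ Set.univ ∧ ¬ ShortIn G B := by
  have hd := big_disjoint hs hA hB hne
  have hu : ∀ {A B : Set V}, Big G A → Big G B → A ≠ B → A ≠ Set.univ := by
    rintro A B hA hB hne rfl
    exact hne (block_univ hA.1 hB.1).symm
  have h2 : j ≤ 2 := by
    by_contra h2
    obtain rfl : j = 3 := by omega
    exact hu hA hB hne (cubic_univ hG hs (block_nonempty hA.1) (memF_cubic hF))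
  exact ⟨h2, hu hB hA hne.symm, fun hS => h (TwoSC.two ⟨A, B, hd, short_val (memF3 h2 hF), hS⟩)⟩

theorem main_thm {V : Type} [Fintype V] (G : SimpleGraph V)
    (hconn : G.Connected) (hsub : Subcubic G) (h : ¬ TwoDisjointCyclesLt G 5) :
    -- (1)
    (Nonempty (G ≃g (⊤ : SimpleGraph (Fin 4))) ∨ ContainsSubgraphCopy K4plus G) ∨
    -- (2)
    (rg 5 G = 2 / 5 ∧ ∃ (ι : Type) (P : V → Option ι) (H : SimpleGraph V),
        AddCutEdges H G ∧ PartitionedBy H P ∧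
        (∀ u v, G.Adj u v → ¬ H.Adj u v → P u ≠ P v) ∧
        (∃ j ≤ 3, MemF 3 j (H.induce (P ⁻¹' {none}))) ∧
        ∀ i : ι, ∃ j ≤ 3, MemF 4 j (H.induce (P ⁻¹' {some i}))) ∨
    -- (3)
    (rg 5 G = 1 / 5 ∧
      ((∃ B : Set V, IsBlock G B ∧ ∃ j ≤ 2, MemF 3 j (G.induce B)) ∨
       (∃ k : ℕ, MemFG 5 3 1 k G) ∨
       (∃ (ι : Type) (P : V → ι) (H : SimpleGraph V),
          AddCutEdges H G ∧ PartitionedBy H P ∧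
          (∀ u v, G.Adj u v → ¬ H.Adj u v → P u ≠ P v) ∧
          ∀ i : ι, (∃ j ≤ 4, MemF 4 j (H.induce (P ⁻¹' {i}))) ∨
            ∃ k : ℕ, MemFG 5 3 0 k (H.induce (P ⁻¹' {i}))))) ∨
    -- (4)
    rg 5 G ≤ 0 := by
  classical
  by_cases h1 : Nonempty (G ≃g (⊤ : SimpleGraph (Fin 4))) ∨ ContainsSubgraphCopy K4plus G
  · exact Or.inl h1
  right
  by_cases h4 : rg 5 G ≤ 0
  · exact Or.inr (Or.inr h4)
  push Not at h4
  obtain ⟨z, hz⟩ := rg_int G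
  have hz1 : (1 : ℤ) ≤ z := by
    rw [hz] at h4
    have : (0 : ℝ) < z := by linarith
    exact_mod_cast this
  have hcl := fun B (hB : Big G B) => big_class hconn hsub h h1 B (block_nonempty hB.1)
  have hle := rg_le G
  have hN := parts_le hconn hsub
  have hbN := bigs_le hsub
  have hfb : {B | Big G B}.Finite := Set.toFinite _
  have hsum : bigSum G = ∑ B ∈ hfb.toFinset, eps 5 (G.induce B) :=
    finsum_mem_eq_finite_toFinset_sum _ hfb
  have hcard : ({B | Big G B}.ncard : ℝ) = ∑ B ∈ hfb.toFinset, (1 : ℝ) := by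
    rw [Set.ncard_eq_toFinset_card _ hfb]; simp
  have hmem : ∀ B, B ∈ hfb.toFinset ↔ Big G B := fun B => by simp
  by_cases hex : ∃ B0, Big G B0 ∧ eps 5 (G.induce B0) = 2 / 5 ∧ ∃ j ≤ 3, MemF 3 j (G.induce B0)
  · obtain ⟨B0, hB0, he0, j0, hj0, hF0⟩ := hex
    -- other blocks
    have hoth : ∀ B, Big G B → B ≠ B0 →
        (eps 5 (G.induce B) = 1 / 5 ∧ ∃ j ≤ 3, MemF 4 j (G.induce B)) ∨ eps 5 (G.induce B) ≤ 0 := by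
      intro B hB hne
      have hbs := big_short hconn hsub h hB0 hB hne.symm hj0 hF0
      rcases hcl B hB with ⟨_, j, hj, hF⟩ | ⟨he, ⟨j, hj, hF⟩ | ⟨k, hF⟩ | ⟨k, hF⟩⟩ | he
      · exfalso
        have hj2 := (big_short hconn hsub h hB hB0 hne hj hF).1
        exact hbs.2.2 (short_val (memF3 hj2 hF))
      · left
        refine ⟨he, j, ?_, hF⟩
        by_contra hj3
        obtain rfl : j = 4 := by omega
        exact hbs.2.1 (cubic_univ hconn hsub (block_nonempty hB.1) (memF_cubic hF))
      · exact absurd (short_val (memFG_short hF)) hbs.2.2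
      · exact absurd (cubic_univ hconn hsub (block_nonempty hB.1) (memFG_cubic hF)) hbs.2.1
      · exact Or.inr he
    have hoth' : ∀ B ∈ hfb.toFinset.erase B0, eps 5 (G.induce B) ≤ 1 / 5 := by
      intro B hB
      rw [Finset.mem_erase, hmem] at hB
      rcases hoth B hB.2 hB.1 with h | h
      · exact h.1.le
      · linarith
    rw [← Finset.add_sum_erase _ _ ((hmem B0).2 hB0), he0] at hsum
    rw [← Finset.add_sum_erase _ _ ((hmem B0).2 hB0)] at hcard
    have hs1 := Finset.sum_le_sum hoth'
    have hs2 : ∑ B ∈ hfb.toFinset.erase B0, (1 / 5 : ℝ) = ({B | Big G B}.ncard - 1) / 5 := by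
      rw [hcard, add_sub_cancel_left, Finset.sum_div]
    have hNr : ((Set.range (part G)).ncard : ℝ) ≤ (twos G).ncard + 1 := by exact_mod_cast hN
    have hbNr : ({B | Big G B}.ncard : ℝ) ≤ (Set.range (part G)).ncard := by exact_mod_cast hbN
    have hz2 : z ≤ 2 := by
      have : (z : ℝ) ≤ 2 := by linarith
      exact_mod_cast this
    by_cases hz3 : z = 2
    · left
      have hr : rg 5 G = 2 / 5 := by rw [hz, hz3]; norm_num
      refine ⟨hr, ?_⟩
      have hb1 : (twos G).ncard + 1 ≤ (Set.range (part G)).ncard := by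
        have : ((twos G).ncard : ℝ) + 1 ≤ (Set.range (part G)).ncard := by linarith
        exact_mod_cast this
      have hb2 : (Set.range (part G)).ncard ≤ {B | Big G B}.ncard := by
        have : ((Set.range (part G)).ncard : ℝ) ≤ {B | Big G B}.ncard := by linarith
        exact_mod_cast this
      have hcov := bigs_cover hsub hb2
      have hall : ∀ B, Big G B → B ≠ B0 → ∃ j ≤ 3, MemF 4 j (G.induce B) := by
        intro B hB hne
        rcases hoth B hB hne with h | h
        · exact h.2
        · exfalso
          have := Finset.sum_lt_sum hoth' ⟨B, Finset.mem_erase.2 ⟨hne, (hmem B).2 hB⟩, by linarith⟩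
          linarith
      let P : V → Option {B : Set V // Big G B ∧ B ≠ B0} := fun v =>
        if hv : part G v = B0 then none else some ⟨part G v, hcov v, hv⟩
      have hPn : P ⁻¹' {none} = B0 := by
        ext v
        by_cases hv : part G v = B0
        · simp only [P, Set.mem_preimage, dif_pos hv, Set.mem_singleton_iff, true_iff]
          rw [← hv]; exact mem_part G v
        · simp only [P, Set.mem_preimage, dif_neg hv, Set.mem_singleton_iff]
          simp only [reduceCtorEq, false_iff]
          exact fun h => hv (part_eq hsub hB0 h)
      have hPs : ∀ i, P ⁻¹' {some i} = i.1 := by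
        rintro ⟨B, hB, hne⟩
        ext v
        by_cases hv : part G v = B0
        · simp only [P, Set.mem_preimage, dif_pos hv, Set.mem_singleton_iff]
          simp only [reduceCtorEq, false_iff]
          exact fun h => hne (by rw [← part_eq hsub hB h, hv])
        · simp only [P, Set.mem_preimage, dif_neg hv, Set.mem_singleton_iff, Option.some.injEq,
            Subtype.mk.injEq]
          constructor
          · intro h; rw [← h]; exact mem_part G v
          · intro h; exact part_eq hsub hB h
      refine ⟨_, P, inner G P, inner_cut hconn hsub hb1 ?_, fun u v h => h.2,
        fun u v huv hn hP => hn ⟨huv, hP⟩, ⟨j0, hj0, ?_⟩, fun i => ?_⟩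
      · intro u v huv
        simp only [P, huv]
      · rw [inner_induce, hPn]; exact hF0
      · rw [inner_induce, hPs]; exact hall _ i.2.1 i.2.2
    · right; left
      have hz4 : z = 1 := by omega
      refine ⟨by rw [hz, hz4]; norm_num, Or.inl ⟨B0, hB0.1, j0, ?_, hF0⟩⟩
      by_contra hj
      obtain rfl : j0 = 3 := by omega
      have hu := cubic_univ hconn hsub (block_nonempty hB0.1) (memF_cubic hF0)
      have hblocks : {B | IsBlock G B} = {B0} := by
        ext B
        simp only [Set.mem_ofPred_eq, Set.mem_singleton_iff]
        constructor
        · intro hB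
          rw [hu]
          exact block_univ (hu ▸ hB0.1) hB
        · rintro rfl; exact hB0.1
      have : rg 5 G = 2 / 5 := by
        unfold rg
        rw [hblocks, finsum_mem_singleton, he0]
      rw [hz, hz4] at this
      norm_num at this
  · right; left
    push Not at hex
    have hoth : ∀ B, Big G B →
        (eps 5 (G.induce B) = 1 / 5 ∧ ((∃ j ≤ 4, MemF 4 j (G.induce B)) ∨
      (∃ k, MemFG 5 3 0 k (G.induce B)) ∨ ∃ k, MemFG 5 3 1 k (G.induce B))) ∨
        eps 5 (G.induce B) ≤ 0 := by
      intro B hB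
      rcases hcl B hB with ⟨he, j, hj, hF⟩ | h | h
      · exact absurd hF (hex B hB he j hj)
      · exact Or.inl h
      · exact Or.inr h
    have hoth' : ∀ B ∈ hfb.toFinset, eps 5 (G.induce B) ≤ 1 / 5 := by
      intro B hB
      rw [hmem] at hB
      rcases hoth B hB with h | h
      · exact h.1.le
      · linarith
    have hs1 := Finset.sum_le_sum hoth'
    have hs2 : ∑ B ∈ hfb.toFinset, (1 / 5 : ℝ) = {B | Big G B}.ncard / 5 := by
      rw [hcard, Finset.sum_div]
    have hNr : ((Set.range (part G)).ncard : ℝ) ≤ (twos G).ncard + 1 := by exact_mod_cast hN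
    have hbNr : ({B | Big G B}.ncard : ℝ) ≤ (Set.range (part G)).ncard := by exact_mod_cast hbN
    have hz2 : z ≤ 1 := by
      have : (z : ℝ) ≤ 1 := by linarith
      exact_mod_cast this
    have hz3 : z = 1 := by omega
    have hr : rg 5 G = 1 / 5 := by rw [hz, hz3]; norm_num
    refine ⟨hr, Or.inr ?_⟩
    have hb1 : (twos G).ncard + 1 ≤ (Set.range (part G)).ncard := by
      have : ((twos G).ncard : ℝ) + 1 ≤ (Set.range (part G)).ncard := by linarith
      exact_mod_cast this
    have hb2 : (Set.range (part G)).ncard ≤ {B | Big G B}.ncard := by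
      have : ((Set.range (part G)).ncard : ℝ) ≤ {B | Big G B}.ncard := by linarith
      exact_mod_cast this
    have hcov := bigs_cover hsub hb2
    by_cases hFG : ∃ B, Big G B ∧ ∃ k, MemFG 5 3 1 k (G.induce B)
    · left
      obtain ⟨B, hB, k, hF⟩ := hFG
      have hu := cubic_univ hconn hsub (block_nonempty hB.1) (memFG_cubic hF)
      subst hu
      exact ⟨k, memFG_iso hF (induceUnivIso G).symm⟩
    · right
      have hall : ∀ B, Big G B → (∃ j ≤ 4, MemF 4 j (G.induce B)) ∨
          (∃ k, MemFG 5 3 0 k (G.induce B)) := by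
        intro B hB
        rcases hoth B hB with ⟨_, h | h | h⟩ | h
        · exact Or.inl h
        · exact Or.inr h
        · exact absurd ⟨B, hB, h⟩ hFG
        · exfalso
          have := Finset.sum_lt_sum hoth' ⟨B, (hmem B).2 hB, by linarith⟩
          linarith
      let P : V → {B : Set V // Big G B} := fun v => ⟨part G v, hcov v⟩
      have hPs : ∀ i, P ⁻¹' {i} = i.1 := by
        rintro ⟨B, hB⟩
        ext v
        simp only [P, Set.mem_preimage, Set.mem_singleton_iff, Subtype.mk.injEq]
        constructor
        · intro h; rw [← h]; exact mem_part G v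
        · intro h; exact part_eq hsub hB h
      refine ⟨_, P, inner G P, inner_cut hconn hsub hb1 ?_, fun u v h => h.2,
        fun u v huv hn hP => hn ⟨huv, hP⟩, fun i => ?_⟩
      · intro u v huv
        exact Subtype.ext huv
      · rw [inner_induce, hPs]; exact hall _ i.2

end Part5

/-- the value of `r_5` on connected subcubic graphs with no two
vertex-disjoint cycles of length less than 5. -/
theorem statement14 {V : Type} [Fintype V] (G : SimpleGraph V)
    (hconn : G.Connected) (hsub : Subcubic G) (h : ¬ TwoDisjointCyclesLt G 5) :
    -- (1)
    (Nonempty (G ≃g (⊤ : SimpleGraph (Fin 4))) ∨ ContainsSubgraphCopy K4plus G) ∨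
    -- (2)
    (rg 5 G = 2 / 5 ∧ ∃ (ι : Type) (P : V → Option ι) (H : SimpleGraph V),
        AddCutEdges H G ∧ PartitionedBy H P ∧
        (∀ u v, G.Adj u v → ¬ H.Adj u v → P u ≠ P v) ∧
        (∃ j ≤ 3, MemF 3 j (H.induce (P ⁻¹' {none}))) ∧
        ∀ i : ι, ∃ j ≤ 3, MemF 4 j (H.induce (P ⁻¹' {some i}))) ∨
    -- (3)
    (rg 5 G = 1 / 5 ∧
      ((∃ B : Set V, IsBlock G B ∧ ∃ j ≤ 2, MemF 3 j (G.induce B)) ∨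
       (∃ k : ℕ, MemFG 5 3 1 k G) ∨
       (∃ (ι : Type) (P : V → ι) (H : SimpleGraph V),
          AddCutEdges H G ∧ PartitionedBy H P ∧
          (∀ u v, G.Adj u v → ¬ H.Adj u v → P u ≠ P v) ∧
          ∀ i : ι, (∃ j ≤ 4, MemF 4 j (H.induce (P ⁻¹' {i}))) ∨
            ∃ k : ℕ, MemFG 5 3 0 k (H.induce (P ⁻¹' {i}))))) ∨
    -- (4)
    rg 5 G ≤ 0 := by
  exact main_thm G hconn hsub h

end InducedForest
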